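/- arXiv:2411.00421 — 9 statements merged into one kernel-verified Lean document; each statement's English description precedes it below -/
import Mathlib

section
/- Let p be a prime and i ≥ 1, and let a be a nonnegative integer divisible by p^{i−1}(p−1). Then the map t ↦ (d_{a+t} mod p^i) is a bijection from {1, 2, …, p^{i−1}(p−1)} onto the group of units of ℤ/p^iℤ. (Equivalently, the restriction to C_{p^i} of the sum of characters L^{d_{a+1}} + ⋯ + L^{d_{a+p^{i−1}(p−1)}} is the representation W_{p^i}, the sum of all faithful complex characters of C_{p^i}, each occurring exactly once.) -/
/-- `acopr p t` is the `t`-th (1-indexed) positive integer coprime to `p`,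
i.e. the increasing enumeration `a_1 < a_2 < ⋯` of positive integers coprime to `p`. -/
noncomputable def acopr (p t : ℕ) : ℕ :=
  Nat.nth (fun k => 0 < k ∧ Nat.Coprime k p) (t - 1)

/-- The sequence `d_1, d_2, …` given by `d_{2t-1} = a_t` and `d_{2t} = -a_t`. -/
noncomputable def dseq (p j : ℕ) : ℤ :=
  if j % 2 = 1 then (acopr p ((j + 1) / 2) : ℤ) else -(acopr p (j / 2) : ℤ)

theorem add_div_add_one_strictMono (s : ℕ) : StrictMono fun n : ℕ => n + n / s + 1 := by
  intro m n h
  have := Nat.div_le_div_right (c := s) h.le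
  dsimp only
  omega

theorem coprime_add_div_add_one {p : ℕ} (hp : p.Prime) (n : ℕ) :
    Nat.Coprime (n + n / (p - 1) + 1) p := by
  obtain ⟨s, rfl⟩ : ∃ s, p = s + 1 := ⟨p - 1, by have := hp.pos; omega⟩
  have hs : 0 < s := by have := hp.two_le; omega
  rw [Nat.add_sub_cancel, Nat.coprime_comm, hp.coprime_iff_not_dvd]
  have h : n + n / s + 1 = (s + 1) * (n / s) + (n % s + 1) := by
    have := Nat.div_add_mod n s
    linarith
  have hr := Nat.mod_lt n hs
  rw [h, Nat.dvd_add_right (dvd_mul_right _ _)]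
  exact fun hd => absurd (Nat.le_of_dvd (Nat.succ_pos _) hd) (by omega)

theorem mem_range_add_div_add_one {p k : ℕ} (hp : p.Prime) (hk : Nat.Coprime k p) :
    k ∈ Set.range fun n : ℕ => n + n / (p - 1) + 1 := by
  obtain ⟨s, rfl⟩ : ∃ s, p = s + 1 := ⟨p - 1, by have := hp.pos; omega⟩
  have hs : 0 < s := by have := hp.two_le; omega
  rw [Nat.coprime_comm, hp.coprime_iff_not_dvd, Nat.dvd_iff_mod_eq_zero] at hk
  have h := Nat.div_add_mod k (s + 1)
  have hr := Nat.mod_lt k (Nat.succ_pos s)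
  obtain ⟨r, hr'⟩ := Nat.exists_eq_succ_of_ne_zero hk
  have hdiv : (s * (k / (s + 1)) + r) / s = k / (s + 1) := by
    rw [Nat.mul_add_div hs, Nat.div_eq_of_lt (a := r) (by grind), Nat.add_zero]
  refine ⟨s * (k / (s + 1)) + r, ?_⟩
  simp only [Nat.add_sub_cancel, hdiv]
  rw [hr', Nat.succ_eq_add_one] at h
  linarith

theorem acopr_eq {p : ℕ} (hp : p.Prime) (t : ℕ) :
    acopr p t = (t - 1) + (t - 1) / (p - 1) + 1 := by
  have hmono := add_div_add_one_strictMono (p - 1)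
  have hP : ∀ n : ℕ, 0 < n + n / (p - 1) + 1 ∧ Nat.Coprime (n + n / (p - 1) + 1) p :=
    fun n => ⟨Nat.succ_pos _, coprime_add_div_add_one hp n⟩
  have key := Nat.nth_comp_of_strictMono (p := fun k => 0 < k ∧ Nat.Coprime k p) (n := t - 1)
    hmono (fun k hk => mem_range_add_div_add_one hp hk.2) (fun hfi => by
      refine absurd (hfi.subset ?_) (Set.infinite_range_of_injective hmono.injective)
      rintro _ ⟨n, rfl⟩
      exact hP n)
  unfold acopr
  rw [← key, funext fun n => eq_true (hP n), Nat.nth_true]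

theorem mul_succ_lt_two_mul_of_le {s M j : ℕ} (hs : 0 < s) (h : M * s ≤ 2 * j) :
    M * (s + 1) < 2 * (j + j / s + 1) := by
  have hj := Nat.lt_div_mul_add (a := j) hs
  have : M < 2 * (j / s) + 2 := by
    refine Nat.lt_of_mul_lt_mul_right (a := s) ?_
    linarith
  linarith

theorem two_mul_lt_mul_succ_of_lt {s M j : ℕ} (hpar : Even (M * s)) (h : 2 * j < M * s) :
    2 * (j + j / s + 1) < M * (s + 1) := by
  have hj := Nat.div_mul_le_self j s
  have hM : 2 * (j / s) < M := by
    refine Nat.lt_of_mul_lt_mul_right (a := s) ?_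
    linarith
  obtain ⟨c, hc⟩ := hpar
  rw [mul_add_one M]
  omega

theorem dseq_eq {p : ℕ} (hp : p.Prime) {j : ℕ} (hj : 1 ≤ j) :
    dseq p j = (if j % 2 = 1 then 1 else -1) *
      (((j - 1) / 2 + (j - 1) / 2 / (p - 1) + 1 : ℕ) : ℤ) := by
  unfold dseq
  split_ifs with h
  · rw [acopr_eq hp, show (j + 1) / 2 - 1 = (j - 1) / 2 by omega, one_mul]
  · rw [acopr_eq hp, show j / 2 - 1 = (j - 1) / 2 by omega, neg_one_mul]

theorem isUnit_dseq {p : ℕ} (hp : p.Prime) (i : ℕ) {j : ℕ} (hj : 1 ≤ j) :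
    IsUnit ((dseq p j : ℤ) : ZMod (p ^ i)) := by
  have h := (ZMod.isUnit_iff_coprime _ (p ^ i)).2
    ((coprime_add_div_add_one hp ((j - 1) / 2)).pow_right i)
  rw [dseq_eq hp hj]
  split_ifs
  · rwa [one_mul, Int.cast_natCast]
  · rwa [neg_one_mul, Int.cast_neg, Int.cast_natCast, IsUnit.neg_iff]

theorem not_dvd_of_mul_lt_of_lt_mul {q k x : ℤ} (h₁ : k * q < x) (h₂ : x < (k + 1) * q) :
    ¬ q ∣ x := by
  rintro ⟨c, rfl⟩
  rw [mul_comm q c] at h₁ h₂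
  have hq : 0 < q := by linarith
  have := lt_of_mul_lt_mul_right h₁ hq.le
  have := lt_of_mul_lt_mul_right h₂ hq.le
  omega

theorem even_totient_prime_pow {p i : ℕ} (hp : p.Prime)
    (h : 1 < p ^ (i - 1) * (p - 1)) : Even (p ^ (i - 1) * (p - 1)) := by
  rcases hp.eq_two_or_odd' with rfl | hodd
  · rcases Nat.eq_zero_or_pos (i - 1) with h0 | h0
    · simp [h0] at h
    · exact ((Nat.even_pow.2 ⟨even_two, h0.ne'⟩)).mul_right _
  · exact (Nat.Odd.sub_odd hodd odd_one).mul_left _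

theorem injOn_dseq {p i a : ℕ} (hp : p.Prime) (hi : 1 ≤ i)
    (ha : p ^ (i - 1) * (p - 1) ∣ a) :
    Set.InjOn (fun t : ℕ => ((dseq p (a + t) : ℤ) : ZMod (p ^ i)))
      (Set.Icc 1 (p ^ (i - 1) * (p - 1))) := by
  rcases le_or_gt (p ^ (i - 1) * (p - 1)) 1 with hle | hlt
  · rintro t ⟨ht₁, ht₂⟩ u ⟨hu₁, hu₂⟩ -
    omega
  have heven := even_totient_prime_pow hp hlt
  obtain ⟨k, rfl⟩ := ha
  have hs : 0 < p - 1 := by have := hp.two_le; omega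
  have hq : p ^ i = p ^ (i - 1) * (p - 1 + 1) := by
    rw [Nat.sub_add_cancel hp.one_le, ← pow_succ, Nat.sub_add_cancel hi]
  set φ := p ^ (i - 1) * (p - 1) with hφ
  set f : ℕ → ℕ := fun n => n + n / (p - 1) + 1
  have f_apply (n : ℕ) : f n = n + n / (p - 1) + 1 := rfl
  have hmono : StrictMono f := add_div_add_one_strictMono (p - 1)
  have hka : Even (φ * k) := heven.mul_right k
  have bounds : ∀ t ∈ Set.Icc 1 φ,
      (k : ℤ) * (p ^ i : ℕ) < 2 * (f ((φ * k + t - 1) / 2) : ℤ) ∧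
        2 * (f ((φ * k + t - 1) / 2) : ℤ) < (k + 1 : ℤ) * (p ^ i : ℕ) := by
    rintro t ⟨ht₁, ht₂⟩
    obtain ⟨c, hc⟩ := hka
    have e₁ : k * p ^ (i - 1) * (p - 1) = φ * k := by rw [hφ]; ring
    have e₂ : (k + 1) * p ^ (i - 1) * (p - 1) = φ * k + φ := by rw [hφ]; ring
    have h₁ := mul_succ_lt_two_mul_of_le (M := k * p ^ (i - 1)) (j := (φ * k + t - 1) / 2) hs
      (by rw [e₁]; omega)
    have h₂ := two_mul_lt_mul_succ_of_lt (s := p - 1) (M := (k + 1) * p ^ (i - 1))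
      (j := (φ * k + t - 1) / 2) (by rw [e₂]; exact (heven.mul_right k).add heven)
      (by rw [e₂]; omega)
    rw [mul_assoc k, ← hq] at h₁
    rw [mul_assoc (k + 1), ← hq] at h₂
    exact ⟨by exact_mod_cast h₁, by exact_mod_cast h₂⟩
  intro t ht u hu htu
  obtain ⟨bt₁, bt₂⟩ := bounds t ht
  obtain ⟨bu₁, bu₂⟩ := bounds u hu
  have ht₁ := ht.1
  have hu₁ := hu.1
  have hsum : ¬ ((p ^ i : ℕ) : ℤ) ∣
      f ((φ * k + t - 1) / 2) + f ((φ * k + u - 1) / 2) :=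
    not_dvd_of_mul_lt_of_lt_mul (k := k) (by linarith) (by linarith)
  have hdiff : ((p ^ i : ℕ) : ℤ) ∣
      f ((φ * k + u - 1) / 2) - f ((φ * k + t - 1) / 2) →
      (φ * k + t - 1) / 2 = (φ * k + u - 1) / 2 := by
    intro hd
    have h0 := Int.eq_zero_of_abs_lt_dvd hd (by rw [abs_lt]; constructor <;> linarith)
    refine hmono.injective ?_
    omega
  obtain ⟨c, hc⟩ := hka
  replace htu := (ZMod.intCast_eq_intCast_iff_dvd_sub _ _ _).1 htu
  rw [dseq_eq hp (by omega), dseq_eq hp (by omega)] at htu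
  simp only [← f_apply] at htu
  split_ifs at htu with h₁ h₂ h₂
  · have := hdiff (by convert htu using 1; ring)
    omega
  · exact absurd (by convert htu using 1; ring) hsum
  · exact absurd (by convert Int.dvd_neg.2 htu using 1; ring) hsum
  · have := hdiff (by convert Int.dvd_neg.2 htu using 1; ring)
    omega

/-- For a prime `p`, `i ≥ 1` and `a` a nonnegative multiple of `p^{i-1}(p-1)`,
the map `t ↦ d_{a+t} mod p^i` is a bijection from `{1, …, p^{i-1}(p-1)}` onto the
units of `ℤ/p^iℤ`. -/
theorem stmt0 (p : ℕ) (hp : p.Prime) (i : ℕ) (hi : 1 ≤ i) (a : ℕ)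
    (ha : p ^ (i - 1) * (p - 1) ∣ a) :
    Set.BijOn (fun t : ℕ => ((dseq p (a + t) : ℤ) : ZMod (p ^ i)))
      (Set.Icc 1 (p ^ (i - 1) * (p - 1)))
      {u : ZMod (p ^ i) | IsUnit u} := by
  have hinj := injOn_dseq hp hi ha
  have hmaps : Set.MapsTo (fun t : ℕ => ((dseq p (a + t) : ℤ) : ZMod (p ^ i)))
      (Set.Icc 1 (p ^ (i - 1) * (p - 1))) {u : ZMod (p ^ i) | IsUnit u} :=
    fun t ht => isUnit_dseq hp i (le_add_left ht.1)
  refine ⟨hmaps, hinj, ?_⟩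
  have : NeZero (p ^ i) := ⟨pow_ne_zero _ hp.ne_zero⟩
  have hunits : {u : ZMod (p ^ i) | IsUnit u} = Set.range ((↑) : (ZMod (p ^ i))ˣ → ZMod (p ^ i)) :=
    rfl
  refine (Set.eq_of_subset_of_ncard_le hmaps.image_subset ?_ (Set.toFinite _)).ge
  rw [hinj.ncard_image, hunits, ← Nat.card_coe_set_eq,
    Nat.card_range_of_injective Units.val_injective, Nat.card_eq_fintype_card,
    ZMod.card_units_eq_totient, Nat.totient_prime_pow hp hi, Set.ncard_eq_toFinset_card']
  simp
end

section
/- Let p be a prime, i ≥ 1, let a be a nonnegative integer divisible by p^{i−1}(p−1), and let ζ ∈ ℂ be a primitive p^i-th root of unity. Then ∏_{t=1}^{p^{i−1}(p−1)} (1 − ζ^{d_{a+t}}) = p. (This computes the geometric C_{p^i}-fixed points of the K-theory Euler class e_{a,b} for b − a = p^{i−1}(p−1).) -/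
section CoprimeEnumeration

variable {p i : ℕ}

theorem setOf_pos_coprime_infinite (hp : p.Prime) :
    (Set.ofPred fun k : ℕ => 0 < k ∧ k.Coprime p).Infinite := by
  refine Set.infinite_of_injective_forall_mem (f := fun k : ℕ => p * k + 1) ?_ fun k => ?_
  · intro x y h
    simpa [hp.ne_zero] using h
  · change 0 < p * k + 1 ∧ (p * k + 1).Coprime p
    simp

theorem count_pos_coprime_prime_pow (hp : p.Prime) (hi : 1 ≤ i) :
    Nat.count (fun k => 0 < k ∧ Nat.Coprime k p) (p ^ i) = p ^ (i - 1) * (p - 1) := by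
  rw [← Nat.totient_prime_pow hp hi, Nat.count_eq_card_filter_range, Nat.totient]
  congr 1
  refine Finset.filter_congr fun x _ => ?_
  rw [Nat.coprime_pow_left_iff hi, Nat.coprime_comm]
  refine ⟨And.right, fun h => ⟨Nat.pos_of_ne_zero ?_, h⟩⟩
  rintro rfl
  exact hp.one_lt.ne' (by simpa using h)

theorem coprime_prime_pow_add_iff (hi : 1 ≤ i) (x : ℕ) :
    (p ^ i + x).Coprime p ↔ x.Coprime p := by
  obtain ⟨j, rfl⟩ := Nat.exists_eq_add_of_le' hi
  rw [pow_succ, add_comm]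
  simp

theorem coprime_prime_pow_sub_iff (hi : 1 ≤ i) {x : ℕ} (hx : x ≤ p ^ i) :
    (p ^ i - x).Coprime p ↔ x.Coprime p := by
  have hd : p ∣ p ^ i := dvd_pow_self p (by omega)
  have key : ∀ y z, y + z = p ^ i → y.Coprime p → z.Coprime p := by
    intro y z h hy
    refine Nat.Coprime.symm (Nat.coprime_of_dvd fun q hq hqp hqz => ?_)
    have : q ∣ y := (Nat.dvd_add_left hqz).1 (h ▸ hqp.trans hd)
    exact hq.one_lt.ne' (Nat.dvd_one.1 (hy ▸ Nat.dvd_gcd this hqp))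
  exact ⟨key _ _ (by omega), key _ _ (by omega)⟩

theorem nth_coprime_add (hp : p.Prime) (hi : 1 ≤ i) (t : ℕ) :
    Nat.nth (fun k => 0 < k ∧ Nat.Coprime k p) (p ^ (i - 1) * (p - 1) + t) =
      p ^ i + Nat.nth (fun k => 0 < k ∧ Nat.Coprime k p) t := by
  have hinf := setOf_pos_coprime_infinite hp
  have hmem := Nat.nth_mem_of_infinite hinf t
  have hcount := Nat.count_nth_of_infinite hinf t
  set x := Nat.nth (fun k => 0 < k ∧ Nat.Coprime k p) t
  have hx : 0 < p ^ i + x ∧ (p ^ i + x).Coprime p :=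
    ⟨by omega, (coprime_prime_pow_add_iff hi x).2 hmem.2⟩
  have hshift : Nat.count (fun k => 0 < p ^ i + k ∧ (p ^ i + k).Coprime p) x = t := by
    rw [← hcount]
    simp only [Nat.count_eq_card_filter_range]
    congr 1
    refine Finset.filter_congr fun y _ => ?_
    rw [coprime_prime_pow_add_iff hi]
    refine ⟨fun h => ⟨Nat.pos_of_ne_zero ?_, h.2⟩, fun h => ⟨by omega, h.2⟩⟩
    rintro rfl
    exact hp.one_lt.ne' (by simpa using h.2)
  conv_rhs => rw [← Nat.nth_count (p := fun k => 0 < k ∧ Nat.Coprime k p) hx]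
  rw [Nat.count_add, hshift, count_pos_coprime_prime_pow hp hi]

theorem count_coprime_reflect (hp : p.Prime) (hi : 1 ≤ i) {x : ℕ} (hx : x < p ^ i) :
    Nat.count (fun k => 0 < k ∧ Nat.Coprime k p) (x + 1) +
      Nat.count (fun k => 0 < k ∧ Nat.Coprime k p) (p ^ i - x) = p ^ (i - 1) * (p - 1) := by
  induction x with
  | zero => simp [Nat.count_succ, count_pos_coprime_prime_pow hp hi]
  | succ x ih =>
    have h := ih (by omega)
    rw [show p ^ i - x = p ^ i - (x + 1) + 1 by omega,
      Nat.count_succ _ (p ^ i - (x + 1))] at h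
    rw [Nat.count_succ _ (x + 1)]
    have hiff := coprime_prime_pow_sub_iff hi hx.le
    have hpos : 0 < p ^ i - (x + 1) := by omega
    simp only [hiff, hpos, true_and, Nat.succ_pos] at h ⊢
    omega

theorem nth_coprime_lt (hp : p.Prime) (hi : 1 ≤ i) {t : ℕ} (ht : t < p ^ (i - 1) * (p - 1)) :
    Nat.nth (fun k => 0 < k ∧ Nat.Coprime k p) t < p ^ i :=
  Nat.nth_lt_of_lt_count (by rwa [count_pos_coprime_prime_pow hp hi])

theorem nth_coprime_reflect (hp : p.Prime) (hi : 1 ≤ i) {s t : ℕ}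
    (hst : s + t + 1 = p ^ (i - 1) * (p - 1)) :
    Nat.nth (fun k => 0 < k ∧ Nat.Coprime k p) s +
      Nat.nth (fun k => 0 < k ∧ Nat.Coprime k p) t = p ^ i := by
  have hinf := setOf_pos_coprime_infinite hp
  have hlt := nth_coprime_lt hp hi (t := t) (by omega)
  have hmem := Nat.nth_mem_of_infinite hinf t
  have hsum := count_coprime_reflect hp hi hlt
  rw [Nat.count_nth_succ_of_infinite hinf] at hsum
  set x := Nat.nth (fun k => 0 < k ∧ Nat.Coprime k p) t
  have hx : 0 < p ^ i - x ∧ (p ^ i - x).Coprime p :=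
    ⟨by omega, (coprime_prime_pow_sub_iff hi hlt.le).2 hmem.2⟩
  have h := Nat.nth_count (p := fun k => 0 < k ∧ Nat.Coprime k p) hx
  rw [show Nat.count (fun k => 0 < k ∧ Nat.Coprime k p) (p ^ i - x) = s by omega] at h
  omega

theorem prod_one_sub_pow_nth_coprime (hp : p.Prime) (hi : 1 ≤ i) {ζ : ℂ}
    (hζ : IsPrimitiveRoot ζ (p ^ i)) :
    ∏ t ∈ Finset.range (p ^ (i - 1) * (p - 1)),
      (1 - ζ ^ Nat.nth (fun k => 0 < k ∧ Nat.Coprime k p) t) = (p : ℂ) := by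
  have hinf := setOf_pos_coprime_infinite hp
  have : Fact p.Prime := ⟨hp⟩
  have hn : 0 < p ^ i := pow_pos hp.pos i
  have h1 : (Polynomial.cyclotomic (p ^ i) ℂ).eval 1 = p := by
    obtain ⟨j, rfl⟩ := Nat.exists_eq_add_of_le' hi
    exact Polynomial.eval_one_cyclotomic_prime_pow j
  rw [← h1, Polynomial.cyclotomic_eq_prod_X_sub_primitiveRoots hζ, Polynomial.eval_prod]
  refine Finset.prod_nbij (fun t => ζ ^ Nat.nth (fun k => 0 < k ∧ Nat.Coprime k p) t)
    ?_ ?_ ?_ ?_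
  · intro t _
    rw [mem_primitiveRoots hn]
    exact hζ.pow_of_coprime _ ((Nat.nth_mem_of_infinite hinf t).2.pow_right i)
  · intro s hs t ht h
    simp only [Finset.coe_range, Set.mem_Iio] at hs ht
    exact Nat.nth_injective hinf
      (hζ.pow_inj (nth_coprime_lt hp hi hs) (nth_coprime_lt hp hi ht) h)
  · intro ξ hξ
    have hξ' := (mem_primitiveRoots hn).1 (Finset.mem_coe.1 hξ)
    obtain ⟨x, hx, hcop, rfl⟩ := hζ.isPrimitiveRoot_iff.1 hξ'
    have hxp : x.Coprime p := (Nat.coprime_pow_right_iff hi _ _).1 hcop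
    have hxm : 0 < x ∧ x.Coprime p := by
      refine ⟨Nat.pos_of_ne_zero ?_, hxp⟩
      rintro rfl
      exact hp.one_lt.ne' (by simpa using hxp)
    refine ⟨Nat.count (fun k => 0 < k ∧ Nat.Coprime k p) x, ?_, ?_⟩
    · rw [Finset.coe_range, Set.mem_Iio, ← count_pos_coprime_prime_pow hp hi]
      exact Nat.count_strict_mono hxm hx
    · simp only [Nat.nth_count (p := fun k => 0 < k ∧ Nat.Coprime k p) hxm]
  · intro t _
    simp

end CoprimeEnumeration

theorem prod_Icc_one_two_mul {M : Type*} [CommMonoid M] (g : ℕ → M) (m : ℕ) :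
    ∏ t ∈ Finset.Icc 1 (2 * m), g t =
      ∏ s ∈ Finset.range m, g (2 * s + 1) * g (2 * s + 2) := by
  induction m with
  | zero => simp
  | succ m ih =>
    rw [Finset.prod_range_succ, ← ih, show 2 * (m + 1) = 2 * m + 1 + 1 by ring,
      Finset.prod_Icc_succ_top (by omega), Finset.prod_Icc_succ_top (by omega), mul_assoc]

theorem prod_range_mul_add_of_reflect {M : Type*} [CommMonoid M] {H : ℕ → M} {m : ℕ}
    (hper : ∀ t, H (2 * m + t) = H t) (hrefl : ∀ s t, s + t + 1 = 2 * m → H s = H t) (k : ℕ) :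
    ∏ s ∈ Finset.range m, H (k * m + s) = ∏ s ∈ Finset.range m, H s := by
  induction k using Nat.twoStepInduction with
  | zero => simp
  | one =>
    rw [← Finset.prod_range_reflect H m]
    refine Finset.prod_congr rfl fun s hs => hrefl _ _ ?_
    have := Finset.mem_range.1 hs
    omega
  | more k ih _ =>
    rw [← ih]
    refine Finset.prod_congr rfl fun s _ => ?_
    rw [← hper (k * m + s)]
    congr 1
    ring

theorem dseq_two_mul_add_one (p s : ℕ) :
    dseq p (2 * s + 1) = Nat.nth (fun k => 0 < k ∧ Nat.Coprime k p) s := by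
  rw [dseq, if_pos (by omega), acopr, show (2 * s + 1 + 1) / 2 - 1 = s by omega]

theorem dseq_two_mul_add_two (p s : ℕ) :
    dseq p (2 * s + 2) = -(Nat.nth (fun k => 0 < k ∧ Nat.Coprime k p) s : ℤ) := by
  rw [dseq, if_neg (by omega), acopr, show (2 * s + 2) / 2 - 1 = s by omega]

/-- For a prime `p`, `i ≥ 1`, `a` a nonnegative multiple of `p^{i-1}(p-1)`, and a
primitive `p^i`-th root of unity `ζ ∈ ℂ`, one has
`∏_{t=1}^{p^{i-1}(p-1)} (1 - ζ^{d_{a+t}}) = p`. -/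
theorem stmt1 (p : ℕ) (hp : p.Prime) (i : ℕ) (hi : 1 ≤ i) (a : ℕ)
    (ha : p ^ (i - 1) * (p - 1) ∣ a) (ζ : ℂ) (hζ : IsPrimitiveRoot ζ (p ^ i)) :
    ∏ t ∈ Finset.Icc 1 (p ^ (i - 1) * (p - 1)), (1 - ζ ^ dseq p (a + t)) = (p : ℂ) := by
  have hprod := prod_one_sub_pow_nth_coprime hp hi hζ
  have hadd := nth_coprime_add hp hi
  have hreflect := fun s t => nth_coprime_reflect hp hi (s := s) (t := t)
  have heven : p ^ (i - 1) * (p - 1) = 1 ∨ Even (p ^ (i - 1) * (p - 1)) := by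
    rw [← Nat.totient_prime_pow hp hi]
    rcases Nat.lt_or_ge 2 (p ^ i) with h | h
    · exact .inr (Nat.totient_even h)
    · have : 0 < p ^ i := pow_pos hp.pos i
      exact .inl (by interval_cases p ^ i <;> simp)
  have hζ0 : ζ ≠ 0 := hζ.ne_zero (pow_pos hp.pos i).ne'
  have hζn := hζ.pow_eq_one
  generalize p ^ (i - 1) * (p - 1) = φ at *
  set f := Nat.nth (fun k => 0 < k ∧ Nat.Coprime k p)
  have hpow_add : ∀ t, ζ ^ f (φ + t) = ζ ^ f t := fun t => by
    rw [hadd, pow_add, hζn, one_mul]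
  have hpow_reflect : ∀ s t, s + t + 1 = φ → (ζ ^ f s)⁻¹ = ζ ^ f t := fun s t h =>
    inv_eq_of_mul_eq_one_right (by rw [← pow_add, hreflect s t h, hζn])
  obtain ⟨k, rfl⟩ := ha
  rcases heven with rfl | ⟨m, rfl⟩
  · have hconst : ∀ t, ζ ^ f t = ζ ^ f 0 := fun t => by
      induction t with
      | zero => rfl
      | succ t ih => rw [add_comm, hpow_add, ih]
    simp only [Finset.range_one, Finset.prod_singleton] at hprod
    rw [Finset.Icc_self, Finset.prod_singleton, one_mul]
    obtain ⟨s, rfl | rfl⟩ := Nat.even_or_odd' k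
    · rw [dseq_two_mul_add_one, zpow_natCast, hconst, hprod]
    · rw [dseq_two_mul_add_two, zpow_neg, zpow_natCast, hconst, hpow_reflect 0 0 rfl, hprod]
  · rw [← two_mul] at *
    have hH := prod_range_mul_add_of_reflect (m := m)
      (H := fun t => (1 - ζ ^ f t) * (1 - (ζ ^ f t)⁻¹)) (fun t => by simp only [hpow_add])
      (fun s t h => by
        simp only [hpow_reflect s t h, hpow_reflect t s (by omega)]
        ring) k
    rw [prod_Icc_one_two_mul]
    calc
      _ = ∏ s ∈ Finset.range m,
          (1 - ζ ^ f (k * m + s)) * (1 - (ζ ^ f (k * m + s))⁻¹) := by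
        refine Finset.prod_congr rfl fun s _ => ?_
        rw [show 2 * m * k + (2 * s + 1) = 2 * (k * m + s) + 1 by ring,
          show 2 * m * k + (2 * s + 2) = 2 * (k * m + s) + 2 by ring,
          dseq_two_mul_add_one, dseq_two_mul_add_two, zpow_neg, zpow_natCast]
      _ = ∏ s ∈ Finset.range m, (1 - ζ ^ f s) * (1 - (ζ ^ f s)⁻¹) := hH
      _ = p := by
        rw [← hprod, two_mul, Finset.prod_range_add, Finset.prod_mul_distrib,
          ← Finset.prod_range_reflect (fun s => 1 - ζ ^ f (m + s))]
        congr 1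
        refine Finset.prod_congr rfl fun s hs => ?_
        have := Finset.mem_range.1 hs
        rw [hpow_reflect s (m + (m - 1 - s)) (by omega)]
end

section
/- Let p be a prime and n ≥ 0. In R_n = ℤ[X]/(X^{p^n} − 1), for all 0 ≤ i, j ≤ n one has Z_i · Z_j = 0 if i ≠ j, and Z_i · Z_i = p^{n+1−i} · Z_i. (Hence the augmentation ideal of the Burnside ring A(C_{p^n}) splits multiplicatively as a product of the ideals generated by the z_{n,i}.) -/
open Polynomial

noncomputable section

/-- The ring `R_n = ℤ[X]/(X^{p^n} - 1)`, the complex representation ring `RU(C_{p^n})`. -/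
abbrev Rring (p n : ℕ) : Type :=
  Polynomial ℤ ⧸ Ideal.span {(X : Polynomial ℤ) ^ p ^ n - 1}

/-- The residue class `x` of `X` in `R_n`. -/
def xcl (p n : ℕ) : Rring p n := Ideal.Quotient.mk _ X

theorem xcl_pow (p n : ℕ) : xcl p n ^ p ^ n = 1 := by
  unfold xcl
  have hmem : ((X : Polynomial ℤ) ^ p ^ n - 1) ∈
      Ideal.span {(X : Polynomial ℤ) ^ p ^ n - 1} :=
    Ideal.subset_span (Set.mem_singleton _)
  have h0 := Ideal.Quotient.eq_zero_iff_mem.mpr hmem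
  rw [map_sub, map_pow, map_one] at h0
  exact sub_eq_zero.mp h0

/-- `x` as a unit of `R_n` (its inverse is `x^{p^n - 1}`). -/
def xunit (p n : ℕ) (hp : 0 < p) : (Rring p n)ˣ :=
  Units.mkOfMulEqOne (xcl p n) (xcl p n ^ (p ^ n - 1)) (by
    have h1 : p ^ n - 1 + 1 = p ^ n := by
      have := pow_pos hp n; omega
    calc xcl p n * xcl p n ^ (p ^ n - 1) = xcl p n ^ (p ^ n - 1 + 1) := by ring
      _ = 1 := by rw [h1, xcl_pow])

/-- `x^d` for an arbitrary integer `d` (using that `x` is a unit of `R_n`). -/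
def xz (p n : ℕ) (hp : 0 < p) (d : ℤ) : Rring p n :=
  ((xunit p n hp ^ d : (Rring p n)ˣ) : Rring p n)

/-- `T_i = Σ_{t=0}^{p^{n-i}-1} x^{t·p^i}`, the class of the transitive
`C_{p^n}`-set `C_{p^n}/C_{p^i}` under the marks isomorphism. -/
def Tel (p n i : ℕ) : Rring p n :=
  ∑ t ∈ Finset.range (p ^ (n - i)), xcl p n ^ (t * p ^ i)

/-- `Z_0 = p·T_0` and `Z_i = p·T_i - T_{i-1}` for `i ≥ 1`. -/
def Zel (p n i : ℕ) : Rring p n :=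
  if i = 0 then (p : Rring p n) * Tel p n 0
  else (p : Rring p n) * Tel p n i - Tel p n (i - 1)

end

theorem xcl_pow_mul_Tel {p n i : ℕ} (hi : i ≤ n) : xcl p n ^ p ^ i * Tel p n i = Tel p n i := by
  have h := mul_geom_sum (xcl p n ^ p ^ i) (p ^ (n - i))
  rw [← pow_mul, ← pow_add, Nat.add_sub_cancel' hi, xcl_pow, sub_self] at h
  have hT : Tel p n i = ∑ t ∈ Finset.range (p ^ (n - i)), (xcl p n ^ p ^ i) ^ t :=
    Finset.sum_congr rfl fun t _ => by rw [← pow_mul, mul_comm]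
  rw [← hT, sub_mul, one_mul] at h
  exact sub_eq_zero.mp h

theorem xcl_pow_pow_mul_Tel {p n i : ℕ} (hi : i ≤ n) (m : ℕ) :
    (xcl p n ^ p ^ i) ^ m * Tel p n i = Tel p n i := by
  induction m with
  | zero => simp
  | succ m ih => rw [pow_succ, mul_assoc, xcl_pow_mul_Tel hi, ih]

theorem Tel_mul_Tel {p n i j : ℕ} (hij : i ≤ j) (hj : j ≤ n) :
    Tel p n j * Tel p n i = (p : Rring p n) ^ (n - j) * Tel p n i := by
  have h : ∀ t ∈ Finset.range (p ^ (n - j)),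
      xcl p n ^ (t * p ^ j) * Tel p n i = Tel p n i := fun t _ => by
    have he : t * p ^ j = p ^ i * (t * p ^ (j - i)) := by
      rw [mul_left_comm, ← pow_add, Nat.add_sub_cancel' hij]
    rw [he, pow_mul, xcl_pow_pow_mul_Tel (hij.trans hj)]
  conv_lhs => rw [Tel, Finset.sum_mul, Finset.sum_congr rfl h]
  rw [Finset.sum_const, Finset.card_range, nsmul_eq_mul, Nat.cast_pow]

theorem Zel_zero (p n : ℕ) : Zel p n 0 = p * Tel p n 0 := if_pos rfl

theorem Zel_succ (p n i : ℕ) : Zel p n (i + 1) = p * Tel p n (i + 1) - Tel p n i :=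
  if_neg i.succ_ne_zero

theorem Zel_mul_Tel_of_lt {p n i j : ℕ} (hij : i < j) (hj : j ≤ n) :
    Zel p n j * Tel p n i = 0 := by
  obtain ⟨j, rfl⟩ := Nat.exists_eq_add_one_of_ne_zero (Nat.ne_zero_of_lt hij)
  have hs : n - j = n - (j + 1) + 1 := by omega
  rw [Zel_succ, sub_mul, mul_assoc, Tel_mul_Tel hij.le hj,
    Tel_mul_Tel (Nat.le_of_lt_succ hij) (Nat.le_of_succ_le hj), hs]
  ring

theorem Zel_mul_Zel_of_lt {p n i j : ℕ} (hij : i < j) (hj : j ≤ n) :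
    Zel p n j * Zel p n i = 0 := by
  cases i with
  | zero => rw [Zel_zero, mul_left_comm, Zel_mul_Tel_of_lt hij hj, mul_zero]
  | succ i =>
    rw [Zel_succ, mul_sub, mul_left_comm, Zel_mul_Tel_of_lt hij hj,
      Zel_mul_Tel_of_lt (Nat.lt_of_succ_lt hij) hj, mul_zero, sub_zero]

theorem Zel_mul_self {p n i : ℕ} (hi : i ≤ n) :
    Zel p n i * Zel p n i = (p : Rring p n) ^ (n + 1 - i) * Zel p n i := by
  cases i with
  | zero =>
    have h := Tel_mul_Tel (p := p) le_rfl hi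
    rw [Nat.sub_zero] at h
    rw [Zel_zero, mul_mul_mul_comm, h, Nat.sub_zero]
    ring
  | succ i =>
    have h := Tel_mul_Tel (p := p) le_rfl hi
    have hs : n + 1 - (i + 1) = n - (i + 1) + 1 := by omega
    conv_lhs => rhs; rw [Zel_succ]
    rw [mul_sub, Zel_mul_Tel_of_lt i.lt_succ_self hi, sub_zero, Zel_succ, mul_left_comm, sub_mul,
      mul_assoc, h, mul_comm (Tel p n i), Tel_mul_Tel i.le_succ hi, hs]
    ring

/-- `Z_i · Z_j = 0` for `i ≠ j` and `Z_i · Z_i = p^{n+1-i} · Z_i`, for `0 ≤ i, j ≤ n`. -/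
theorem stmt4 (p n : ℕ) (hp : p.Prime) (i j : ℕ) (hin : i ≤ n) (hjn : j ≤ n) :
    (i ≠ j → Zel p n i * Zel p n j = 0) ∧
      Zel p n i * Zel p n i = (p : Rring p n) ^ (n + 1 - i) * Zel p n i := by
  refine ⟨fun hij => ?_, Zel_mul_self hin⟩
  rcases lt_or_gt_of_ne hij with h | h
  · rw [mul_comm, Zel_mul_Zel_of_lt h hjn]
  · exact Zel_mul_Zel_of_lt h hin
end

section
/- Let p be a prime and n ≥ 1. In R_n = ℤ[X]/(X^{p^n} − 1) one has the identity ∏_{1 ≤ k < p^n, p ∤ k} (1 − x^k) = Σ_{j=1}^{n} p^{p^{n−j} − (n+1−j)} · Z_j, where each exponent p^{n−j} − (n+1−j) is a nonnegative integer. (This expresses the K-theory Euler class e_{W_{p^n}} of the fixed-point-free irreducible rational representation W_{p^n} of C_{p^n} in the basis {Z_j} of the augmentation ideal of the Burnside ring.) -/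
open Polynomial

theorem X_pow_sub_one_dvd_of_aeval_eq_zero {N : ℕ} (hN : 0 < N) (f : ℤ[X])
    (h : ∀ z : ℂ, z ^ N = 1 → aeval z f = 0) : (X : ℤ[X]) ^ N - 1 ∣ f := by
  have hmonic : ((X : ℤ[X]) ^ N - 1).Monic := monic_X_pow_sub_C 1 hN.ne'
  rw [← map_dvd_map (Int.castRingHom ℂ) Int.cast_injective hmonic]
  simp only [Polynomial.map_sub, Polynomial.map_pow, map_X, Polynomial.map_one]
  rw [X_pow_sub_one_eq_prod hN (Complex.isPrimitiveRoot_exp N hN.ne')]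
  refine Finset.prod_dvd_of_coprime
    (fun a _ b _ hab => pairwise_coprime_X_sub_C Function.injective_id hab) fun z hz => ?_
  rw [dvd_iff_isRoot, IsRoot.def, eval_map, ← algebraMap_int_eq, ← aeval_def]
  exact h z ((mem_nthRootsFinset hN _).mp hz)

/-- The character of `R_n` sending `x` to a `p ^ n`-th root of unity `z`. -/
noncomputable def evalRoot (p n : ℕ) (z : ℂ) (hz : z ^ p ^ n = 1) : Rring p n →+* ℂ :=
  Ideal.Quotient.lift _ (aeval z : ℤ[X] →ₐ[ℤ] ℂ).toRingHom fun a ha => by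
    obtain ⟨b, rfl⟩ := Ideal.mem_span_singleton.mp ha
    simp [hz]

@[simp]
theorem evalRoot_xcl (p n : ℕ) (z : ℂ) (hz : z ^ p ^ n = 1) :
    evalRoot p n z hz (xcl p n) = z := by
  simp [evalRoot, xcl]

theorem Rring_ext {p n : ℕ} (hp : 0 < p) {a b : Rring p n}
    (h : ∀ z hz, evalRoot p n z hz a = evalRoot p n z hz b) : a = b := by
  obtain ⟨f, rfl⟩ := Ideal.Quotient.mk_surjective a
  obtain ⟨g, rfl⟩ := Ideal.Quotient.mk_surjective b
  rw [Ideal.Quotient.eq, Ideal.mem_span_singleton]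
  refine X_pow_sub_one_dvd_of_aeval_eq_zero (pow_pos hp n) _ fun z hz => ?_
  rw [map_sub, sub_eq_zero]
  simpa [evalRoot] using h z hz

theorem evalRoot_Tel {p n m i : ℕ} (hp : p.Prime) (hin : i ≤ n) {z : ℂ} (hz : z ^ p ^ n = 1)
    (hprim : IsPrimitiveRoot z (p ^ m)) :
    evalRoot p n z hz (Tel p n i) = if m ≤ i then (p : ℂ) ^ (n - i) else 0 := by
  simp only [Tel, map_sum, map_pow, evalRoot_xcl, mul_comm _ (p ^ i), pow_mul]
  split_ifs with hmi
  · rw [(hprim.pow_eq_one_iff_dvd _).mpr (pow_dvd_pow p hmi)]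
    simp
  · have hne : z ^ p ^ i ≠ 1 := fun h1 =>
      hmi ((Nat.pow_dvd_pow_iff_le_right hp.one_lt).mp ((hprim.pow_eq_one_iff_dvd _).mp h1))
    rw [geom_sum_eq hne, ← pow_mul, ← pow_add, Nat.add_sub_cancel' hin, hz, sub_self, zero_div]

theorem evalRoot_Zel {p n m j : ℕ} (hp : p.Prime) (hj : 1 ≤ j) (hjn : j ≤ n) {z : ℂ}
    (hz : z ^ p ^ n = 1) (hprim : IsPrimitiveRoot z (p ^ m)) :
    evalRoot p n z hz (Zel p n j) = if j = m then (p : ℂ) ^ (n + 1 - j) else 0 := by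
  rw [Zel, if_neg (by omega), map_sub, map_mul, map_natCast, evalRoot_Tel hp hjn hz hprim,
    evalRoot_Tel hp (by omega) hz hprim, show n - (j - 1) = n - j + 1 by omega,
    show n + 1 - j = n - j + 1 by omega, pow_succ']
  split_ifs <;> first | omega | simp

theorem prod_range_mul_of_periodic {M : Type*} [CommMonoid M] {g : ℕ → M} {a : ℕ}
    (hg : Function.Periodic g a) (b : ℕ) :
    ∏ k ∈ Finset.range (a * b), g k = (∏ k ∈ Finset.range a, g k) ^ b := by
  induction b with
  | zero => simp
  | succ b ih =>
    rw [mul_add_one, Finset.prod_range_add, ih, pow_succ]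
    congr 1
    refine Finset.prod_congr rfl fun k _ => ?_
    rw [add_comm, mul_comm]
    exact hg.nat_mul b k

theorem prod_one_sub_pow_of_isPrimitiveRoot {p m : ℕ} (hp : p.Prime) (hm : 1 ≤ m) {z : ℂ}
    (hprim : IsPrimitiveRoot z (p ^ m)) :
    ∏ k ∈ (Finset.range (p ^ m)).filter (fun k => ¬ p ∣ k), (1 - z ^ k) = (p : ℂ) := by
  obtain ⟨m, rfl⟩ := Nat.exists_eq_add_of_le' hm
  have := Fact.mk hp
  have hcop (k : ℕ) : ¬ p ∣ k ↔ k.Coprime (p ^ (m + 1)) := by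
    rw [Nat.coprime_pow_right_iff m.succ_pos, Nat.coprime_comm, hp.coprime_iff_not_dvd]
  have hpos : 0 < p ^ (m + 1) := pow_pos hp.pos _
  have heval := eval_one_cyclotomic_prime_pow (R := ℂ) (p := p) m
  rw [cyclotomic_eq_prod_X_sub_primitiveRoots hprim, eval_prod] at heval
  rw [← heval]
  refine Finset.prod_bij (fun k _ => z ^ k) ?_ ?_ ?_ (fun k _ => by simp)
  · intro k hk
    rw [mem_primitiveRoots hpos]
    exact hprim.pow_of_coprime k ((hcop k).mp (Finset.mem_filter.mp hk).2)
  · intro k hk l hl hkl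
    simp only [Finset.mem_filter, Finset.mem_range] at hk hl
    exact hprim.pow_inj hk.1 hl.1 hkl
  · intro w hw
    obtain ⟨k, hk, hkc, rfl⟩ :=
      (hprim.isPrimitiveRoot_iff).mp ((mem_primitiveRoots hpos).mp hw)
    exact ⟨k, by simp [hk, (hcop k).mpr hkc], rfl⟩

theorem prod_one_sub_pow_of_isPrimitiveRoot_of_le {p n m : ℕ} (hp : p.Prime) (hm : 1 ≤ m)
    (hmn : m ≤ n) {z : ℂ} (hprim : IsPrimitiveRoot z (p ^ m)) :
    ∏ k ∈ (Finset.range (p ^ n)).filter (fun k => ¬ p ∣ k), (1 - z ^ k)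
      = (p : ℂ) ^ p ^ (n - m) := by
  have hper : Function.Periodic (fun k => if ¬ p ∣ k then 1 - z ^ k else 1) (p ^ m) := by
    intro k
    simp only [pow_add, hprim.pow_eq_one, mul_one,
      ← Nat.dvd_add_iff_left (dvd_pow_self p (by omega : m ≠ 0))]
  rw [← prod_one_sub_pow_of_isPrimitiveRoot hp hm hprim, Finset.prod_filter, Finset.prod_filter,
    ← prod_range_mul_of_periodic hper, ← pow_add, Nat.add_sub_cancel' hmn]

theorem succ_sub_le_pow {p : ℕ} (hp : 1 < p) {n j : ℕ} (hjn : j ≤ n) :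
    n + 1 - j ≤ p ^ (n - j) := by
  have := Nat.lt_pow_self hp (n := n - j)
  omega

/-- The K-theory Euler class identity
`∏_{1 ≤ k < p^n, p ∤ k} (1 - x^k) = Σ_{j=1}^n p^{p^{n-j} - (n+1-j)} · Z_j` in `R_n`,
where each exponent `p^{n-j} - (n+1-j)` is a nonnegative integer
(i.e. `n + 1 - j ≤ p^{n-j}`). -/
theorem stmt5 (p n : ℕ) (hp : p.Prime) (hn : 1 ≤ n) :
    (∀ j, 1 ≤ j → j ≤ n → n + 1 - j ≤ p ^ (n - j)) ∧
    ∏ k ∈ (Finset.Ico 1 (p ^ n)).filter (fun k => ¬ p ∣ k), (1 - xcl p n ^ k)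
      = ∑ j ∈ Finset.Icc 1 n, (p : Rring p n) ^ (p ^ (n - j) - (n + 1 - j)) * Zel p n j := by
  refine ⟨fun j _ hjn => succ_sub_le_pow hp.one_lt hjn, Rring_ext hp.pos fun z hz => ?_⟩
  obtain ⟨m, hmn, hord⟩ := (Nat.dvd_prime_pow hp).mp (orderOf_dvd_of_pow_eq_one hz)
  have hprim : IsPrimitiveRoot z (p ^ m) := hord ▸ IsPrimitiveRoot.orderOf z
  have hset : (Finset.Ico 1 (p ^ n)).filter (fun k => ¬ p ∣ k)
      = (Finset.range (p ^ n)).filter (fun k => ¬ p ∣ k) := by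
    ext k
    simp only [Finset.mem_filter, Finset.mem_Ico, Finset.mem_range]
    exact ⟨fun h => ⟨h.1.2, h.2⟩, fun h =>
      ⟨⟨Nat.pos_of_ne_zero fun h0 => h.2 (h0 ▸ dvd_zero p), h.1⟩, h.2⟩⟩
  have hterm : ∀ j ∈ Finset.Icc 1 n,
      (p : ℂ) ^ (p ^ (n - j) - (n + 1 - j)) * evalRoot p n z hz (Zel p n j)
        = if j = m then (p : ℂ) ^ p ^ (n - m) else 0 := by
    intro j hj
    obtain ⟨hj1, hjn⟩ := Finset.mem_Icc.mp hj
    rw [evalRoot_Zel hp hj1 hjn hz hprim]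
    split_ifs with hjm
    · rw [← pow_add, Nat.sub_add_cancel (succ_sub_le_pow hp.one_lt hjn), hjm]
    · exact mul_zero _
  simp only [hset, map_prod, map_sum, map_sub, map_one, map_mul, map_pow, map_natCast,
    evalRoot_xcl]
  rw [Finset.sum_congr rfl hterm, Finset.sum_ite_eq']
  split_ifs with hm
  · exact prod_one_sub_pow_of_isPrimitiveRoot_of_le hp (Finset.mem_Icc.mp hm).1 hmn hprim
  · obtain rfl : m = 0 := by
      by_contra h0
      exact hm (Finset.mem_Icc.mpr ⟨by omega, hmn⟩)
    obtain rfl : z = 1 := by simpa using hprim.pow_eq_one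
    refine Finset.prod_eq_zero (i := 1) ?_ (by simp)
    simp [hp.ne_one, Nat.one_lt_pow (by omega : n ≠ 0) hp.one_lt]
end

section
/- Let m ≥ 2, k ≥ 0, and let ℓ ≥ 1 be an integer coprime to m. Then in ℤ[X]/(X^m − 1), with x the residue class of X, one has ∏_{0<d<m, gcd(d,m)=1} (Σ_{i=0}^{ℓ−1} x^{i·d})^k = 1 + ((ℓ^{k·φ(m)} − 1)/m) · Σ_{j=0}^{m−1} x^j, where φ is Euler's totient function and (ℓ^{k·φ(m)} − 1)/m is an integer (by Euler's theorem when k ≥ 1, and equals 0 when k = 0). (This expresses the Adams operation formula ψ^ℓ(β_{W_m}^k) = (1 + ((ℓ^{kφ(m)}−1)/m)·tr_e^{C_m}(1))·β_{W_m}^k in equivariant K-theory.) -/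
open Polynomial

noncomputable section

/-- The ring `ℤ[X]/(X^m - 1)`. -/
abbrev Sring (m : ℕ) : Type :=
  Polynomial ℤ ⧸ Ideal.span {(X : Polynomial ℤ) ^ m - 1}

/-- The residue class `x` of `X` in `ℤ[X]/(X^m - 1)`. -/
def ycl (m : ℕ) : Sring m := Ideal.Quotient.mk _ X

end

/-- Modulo `X ^ m - 1`, powers of `X` only depend on the exponent modulo `m`. -/
theorem X_pow_sub_one_dvd_X_pow_sub_X_pow_mod (m n : ℕ) :
    (X : ℤ[X]) ^ m - 1 ∣ X ^ n - X ^ (n % m) := by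
  have h : (X : ℤ[X]) ^ n - X ^ (n % m) = X ^ (n % m) * ((X ^ m) ^ (n / m) - 1) := by
    rw [mul_sub, mul_one, ← pow_mul, ← pow_add, Nat.mod_add_div]
  rw [h]
  exact (sub_one_dvd_pow_sub_one _ _).mul_left _

/-- `1 + X + ⋯ + X ^ (m - 1)` is relatively prime to `X - 1` over `ℤ`. -/
theorem geom_sum_dvd_of_dvd_mul_X_sub_one {m : ℕ} (hm : m ≠ 0) {a : ℤ[X]}
    (h : (∑ j ∈ Finset.range m, (X : ℤ[X]) ^ j) ∣ a * (X - 1)) :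
    (∑ j ∈ Finset.range m, (X : ℤ[X]) ^ j) ∣ a := by
  obtain ⟨c, hc⟩ := h
  have hc1 : c.eval 1 = 0 := by
    have := congrArg (eval 1) hc
    simpa [eval_finsetSum, hm] using this
  obtain ⟨b, rfl⟩ : (X - 1 : ℤ[X]) ∣ c := by
    simpa using dvd_iff_isRoot.mpr hc1
  refine ⟨b, mul_right_cancel₀ (b := (X - 1 : ℤ[X])) ?_ (by rw [hc]; ring)⟩
  simpa using X_sub_C_ne_zero (1 : ℤ)

/-- `1 + X + ⋯ + X ^ (m - 1)` is relatively prime to `X ^ d - 1` over `ℤ` when `d` is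
coprime to `m`. -/
theorem geom_sum_dvd_of_dvd_mul_X_pow_sub_one {m d : ℕ} (hm : 2 ≤ m) (hd : d.Coprime m)
    {a : ℤ[X]} (h : (∑ j ∈ Finset.range m, (X : ℤ[X]) ^ j) ∣ a * (X ^ d - 1)) :
    (∑ j ∈ Finset.range m, (X : ℤ[X]) ^ j) ∣ a := by
  obtain ⟨e, -, he⟩ := Nat.exists_mul_mod_eq_one_of_coprime hd hm
  refine geom_sum_dvd_of_dvd_mul_X_sub_one (by lia) ?_
  have h₁ : (∑ j ∈ Finset.range m, (X : ℤ[X]) ^ j) ∣ a * ((X ^ d) ^ e - 1) :=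
    h.trans (mul_dvd_mul_left a (sub_one_dvd_pow_sub_one _ _))
  have h₂ : (∑ j ∈ Finset.range m, (X : ℤ[X]) ^ j) ∣ X ^ (d * e) - X ^ (d * e % m) :=
    (Dvd.intro _ (geom_sum_mul X m)).trans (X_pow_sub_one_dvd_X_pow_sub_X_pow_mod m _)
  have h₃ := dvd_sub h₁ (h₂.mul_left a)
  rw [he] at h₃
  convert h₃ using 1
  ring

theorem geom_sum_dvd_of_dvd_mul_prod {m : ℕ} (hm : 2 ≤ m) (s : Finset ℕ)
    (hs : ∀ d ∈ s, d.Coprime m) {a : ℤ[X]}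
    (h : (∑ j ∈ Finset.range m, (X : ℤ[X]) ^ j) ∣ a * ∏ d ∈ s, (X ^ d - 1)) :
    (∑ j ∈ Finset.range m, (X : ℤ[X]) ^ j) ∣ a := by
  induction s using Finset.induction_on generalizing a with
  | empty => simpa using h
  | insert d s hd ih =>
    rw [Finset.prod_insert hd, ← mul_assoc] at h
    exact geom_sum_dvd_of_dvd_mul_X_pow_sub_one hm (hs d (by simp))
      (ih (fun e he => hs e (by simp [he])) h)

/-- Multiplication by a unit modulo `m` permutes the reduced residues. -/
theorem prod_coprime_mul_mod {M : Type*} [CommMonoid M] {m ℓ : ℕ} (hm : 2 ≤ m)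
    (hco : ℓ.Coprime m) (f : ℕ → M) :
    ∏ d ∈ (Finset.Ico 1 m).filter (fun d => Nat.Coprime d m), f (ℓ * d % m) =
      ∏ d ∈ (Finset.Ico 1 m).filter (fun d => Nat.Coprime d m), f d := by
  have hmaps : Set.MapsTo (fun d => ℓ * d % m)
      ((Finset.Ico 1 m).filter (fun d => Nat.Coprime d m))
      ((Finset.Ico 1 m).filter (fun d => Nat.Coprime d m)) := by
    intro d hd
    simp only [Finset.coe_filter, Finset.mem_Ico, Set.mem_ofPred_eq] at hd ⊢
    have hc : (ℓ * d % m).Coprime m := by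
      rw [Nat.Coprime, ← Nat.gcd_rec, Nat.gcd_comm]
      exact hco.mul_left hd.2
    refine ⟨⟨Nat.pos_of_ne_zero fun h0 => ?_, Nat.mod_lt _ (by lia)⟩, hc⟩
    rw [h0, Nat.coprime_zero_left] at hc
    lia
  have hinj : Set.InjOn (fun d => ℓ * d % m)
      ((Finset.Ico 1 m).filter (fun d => Nat.Coprime d m)) := by
    intro d hd e he h
    simp only [Finset.coe_filter, Finset.mem_Ico, Set.mem_ofPred_eq] at hd he
    have : d ≡ e [MOD m] := Nat.ModEq.cancel_left_of_coprime hco.symm h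
    exact this.eq_of_lt_of_lt hd.1.2 he.1.2
  exact Finset.prod_nbij _ hmaps hinj
    (Finset.surjOn_of_injOn_of_card_le _ hmaps hinj le_rfl) fun _ _ => rfl

/-- The product of the cyclotomic units `(X ^ (ℓ d) - 1) / (X ^ d - 1)` is `1` modulo
`1 + X + ⋯ + X ^ (m - 1)`. -/
theorem geom_sum_dvd_prod_geom_sum_sub_one {m ℓ : ℕ} (hm : 2 ≤ m) (hco : ℓ.Coprime m) :
    (∑ j ∈ Finset.range m, (X : ℤ[X]) ^ j) ∣
      ∏ d ∈ (Finset.Ico 1 m).filter (fun d => Nat.Coprime d m),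
        (∑ i ∈ Finset.range ℓ, (X : ℤ[X]) ^ (i * d)) - 1 := by
  refine geom_sum_dvd_of_dvd_mul_prod hm ((Finset.Ico 1 m).filter (fun d => Nat.Coprime d m))
    (fun d hd => (Finset.mem_filter.mp hd).2) ?_
  have hmul (d : ℕ) : (∑ i ∈ Finset.range ℓ, (X : ℤ[X]) ^ (i * d)) * (X ^ d - 1) =
      X ^ (ℓ * d) - 1 := by
    simpa only [← pow_mul, mul_comm d] using geom_sum_mul ((X : ℤ[X]) ^ d) ℓ
  rw [sub_mul, one_mul, ← Finset.prod_mul_distrib, Finset.prod_congr rfl fun d _ => hmul d,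
    ← prod_coprime_mul_mod hm hco fun d => (X : ℤ[X]) ^ d - 1]
  refine (Dvd.intro _ (geom_sum_mul X m)).trans ?_
  rw [← Ideal.mem_span_singleton, ← Ideal.Quotient.eq, map_prod, map_prod]
  refine Finset.prod_congr rfl fun d _ => ?_
  rw [Ideal.Quotient.eq, Ideal.mem_span_singleton, sub_sub_sub_cancel_right]
  exact X_pow_sub_one_dvd_X_pow_sub_X_pow_mod m _

/-- In `ℤ[X]/(X ^ m - 1)`, a multiple of the norm element only depends on the augmentation of
the multiplier. -/
theorem mk_geom_sum_mul (m : ℕ) (q : ℤ[X]) :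
    (Ideal.Quotient.mk (Ideal.span {(X : ℤ[X]) ^ m - 1})
      ((∑ j ∈ Finset.range m, X ^ j) * q) : Sring m) =
      ((q.eval 1 : ℤ) : Sring m) * ∑ j ∈ Finset.range m, ycl m ^ j := by
  have hN : (∑ j ∈ Finset.range m, ycl m ^ j) =
      Ideal.Quotient.mk (Ideal.span {(X : ℤ[X]) ^ m - 1}) (∑ j ∈ Finset.range m, X ^ j) := by
    simp [ycl]
  rw [hN, ← map_intCast (Ideal.Quotient.mk (Ideal.span {(X : ℤ[X]) ^ m - 1})), ← map_mul,
    Ideal.Quotient.eq, Ideal.mem_span_singleton, mul_comm _ q, ← sub_mul, ← geom_sum_mul, mul_comm]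
  refine mul_dvd_mul_right ?_ _
  simpa using X_sub_C_dvd_sub_C_eval (p := q) (a := 1)

theorem card_filter_coprime_Ico {m : ℕ} (hm : 2 ≤ m) :
    ((Finset.Ico 1 m).filter (fun d => Nat.Coprime d m)).card = m.totient := by
  rw [Nat.totient_eq_card_coprime]
  congr 1
  ext d
  simp only [Finset.mem_filter, Finset.mem_Ico, Finset.mem_range, Nat.coprime_comm (n := d)]
  refine ⟨fun h => ⟨h.1.2, h.2⟩, fun h => ⟨⟨Nat.pos_of_ne_zero ?_, h.1⟩, h.2⟩⟩
  rintro rfl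
  have := (Nat.coprime_zero_right m).mp h.2
  lia

/-- The Adams operation formula `ψ^ℓ(β_{W_m}^k) = (1 + ((ℓ^{kφ(m)}−1)/m)·tr_e^{C_m}(1))·β_{W_m}^k`:
in `ℤ[X]/(X^m − 1)`, `∏_{0<d<m, gcd(d,m)=1} (Σ_{i=0}^{ℓ−1} x^{i·d})^k
= 1 + ((ℓ^{k·φ(m)} − 1)/m) · Σ_{j=0}^{m−1} x^j`, where `(ℓ^{k·φ(m)} − 1)/m` is an
integer, i.e. `m ∣ ℓ^{k·φ(m)} − 1`. -/
theorem stmt7 (m k ℓ : ℕ) (hm : 2 ≤ m) (hℓ : 1 ≤ ℓ) (hco : Nat.Coprime ℓ m) :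
    m ∣ ℓ ^ (k * Nat.totient m) - 1 ∧
    ∏ d ∈ (Finset.Ico 1 m).filter (fun d => Nat.Coprime d m),
        (∑ i ∈ Finset.range ℓ, ycl m ^ (i * d)) ^ k
      = 1 + (((ℓ ^ (k * Nat.totient m) - 1) / m : ℕ) : Sring m)
            * ∑ j ∈ Finset.range m, ycl m ^ j := by
  obtain ⟨q, hq⟩ := (geom_sum_dvd_prod_geom_sum_sub_one hm hco).trans
    (sub_one_dvd_pow_sub_one _ k)
  have hev : ((ℓ ^ (k * m.totient) - 1 : ℕ) : ℤ) = m * q.eval 1 := by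
    have h := congrArg (eval 1) hq
    simp only [eval_sub, eval_pow, eval_prod, eval_finsetSum, eval_X, one_pow, eval_one,
      Finset.sum_const, Finset.card_range, Finset.prod_const, card_filter_coprime_Ico hm,
      eval_mul, nsmul_eq_mul, mul_one, ← pow_mul] at h
    rw [Nat.cast_sub (Nat.one_le_pow _ _ hℓ), ← h, mul_comm k]
    push_cast
    rfl
  have hdvd : m ∣ ℓ ^ (k * m.totient) - 1 := Int.natCast_dvd_natCast.mp ⟨_, hev⟩
  refine ⟨hdvd, ?_⟩
  have hquot : (((ℓ ^ (k * m.totient) - 1) / m : ℕ) : ℤ) = q.eval 1 := by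
    rw [Int.natCast_div, hev, Int.mul_ediv_cancel_left _ (by lia)]
  rw [← Int.cast_natCast, hquot, ← mk_geom_sum_mul, ← hq, Finset.prod_pow]
  simp [ycl]
end

section
/- Let p be a prime and n ≥ 1. In R_{n−1} = ℤ[X]/(X^{p^{n−1}} − 1), set S_i = Σ_{t=0}^{p^{n−1−i}−1} x^{t·p^i} for 0 ≤ i ≤ n−1. For any integers c_0, …, c_{n−1}, the element Y = Σ_{i=0}^{n−1} c_i·S_i lies in the ℤ-span of {p·S_0} ∪ {p·S_i − S_{i−1} : 1 ≤ i ≤ n−1} if and only if p^n divides Σ_{i=0}^{n−1} c_i·p^{n−1−i}. (This is the exactness of the sequence 0 → I(C_{p^n}) → A(C_{p^{n−1}}) → ℤ/p^n → 0, where the first map is the C_p-geometric fixed point homomorphism Φ and the second sends a virtual C_{p^{n−1}}-set X to |X| mod p^n.) -/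
open Polynomial

/-- The augmentation `R_n → ℤ` sending `x` to `1`. -/
noncomputable def augmentation (p n : ℕ) : Rring p n →+* ℤ :=
  Ideal.Quotient.lift _ (Polynomial.evalRingHom (1 : ℤ)) (by
    intro a ha
    obtain ⟨b, rfl⟩ := Ideal.mem_span_singleton.mp ha
    simp)

theorem augmentation_xcl (p n : ℕ) : augmentation p n (xcl p n) = 1 := by
  simp [augmentation, xcl]

theorem augmentation_Tel (p n i : ℕ) : augmentation p n (Tel p n i) = (p : ℤ) ^ (n - i) := by
  simp [Tel, augmentation_xcl]

/-- Modulo a subgroup containing every `p·T_i - T_{i-1}`, the class of `T_{n-j}` is that of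
`p^j·T_n`. -/
theorem Tel_sub_pow_smul_mem {p n : ℕ} {W : Submodule ℤ (Rring p n)}
    (hW : ∀ i, 1 ≤ i → i ≤ n → (p : ℤ) • Tel p n i - Tel p n (i - 1) ∈ W)
    (j : ℕ) (hj : j ≤ n) : Tel p n (n - j) - (p : ℤ) ^ j • Tel p n n ∈ W := by
  induction j with
  | zero => simp
  | succ j ih =>
    have h1 := hW (n - j) (by omega) (by omega)
    have h2 := W.sub_mem (W.smul_mem (p : ℤ) (ih (by omega))) h1
    have h3 : n - (j + 1) = n - j - 1 := by omega
    rw [h3]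
    convert h2 using 1
    rw [smul_sub, smul_smul, ← pow_succ']
    abel

theorem sum_smul_Tel_mem_span_iff (p m : ℕ) (c : ℕ → ℤ) :
    (∑ i ∈ Finset.range (m + 1), c i • Tel p m i) ∈
      Submodule.span ℤ
        ({(p : ℤ) • Tel p m 0} ∪
          {y : Rring p m | ∃ i, 1 ≤ i ∧ i ≤ m ∧
            y = (p : ℤ) • Tel p m i - Tel p m (i - 1)})
    ↔ (p : ℤ) ^ (m + 1) ∣ ∑ i ∈ Finset.range (m + 1), c i * (p : ℤ) ^ (m - i) := by
  set W := Submodule.span ℤ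
        ({(p : ℤ) • Tel p m 0} ∪
          {y : Rring p m | ∃ i, 1 ≤ i ∧ i ≤ m ∧
            y = (p : ℤ) • Tel p m i - Tel p m (i - 1)}) with hWdef
  constructor
  · intro h
    have hle : W ≤ (Submodule.span ℤ {(p : ℤ) ^ (m + 1)}).comap
        (augmentation p m).toAddMonoidHom.toIntLinearMap := by
      rw [hWdef, Submodule.span_le]
      rintro y (rfl | ⟨i, hi, him, rfl⟩)
      · have h0 : augmentation p m ((p : ℤ) • Tel p m 0) = (p : ℤ) ^ (m + 1) := by
          rw [map_zsmul, augmentation_Tel, smul_eq_mul, Nat.sub_zero, pow_succ']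
        change augmentation p m ((p : ℤ) • Tel p m 0) ∈ Submodule.span ℤ {(p : ℤ) ^ (m + 1)}
        rw [h0]
        exact Submodule.mem_span_singleton_self _
      · have h0 : augmentation p m ((p : ℤ) • Tel p m i - Tel p m (i - 1)) = 0 := by
          rw [map_sub, map_zsmul, augmentation_Tel, augmentation_Tel, smul_eq_mul, ← pow_succ',
            show m - (i - 1) = m - i + 1 by omega, sub_self]
        change augmentation p m ((p : ℤ) • Tel p m i - Tel p m (i - 1)) ∈
          Submodule.span ℤ {(p : ℤ) ^ (m + 1)}
        rw [h0]
        exact Submodule.zero_mem _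
    have hY : augmentation p m (∑ i ∈ Finset.range (m + 1), c i • Tel p m i) ∈
        Ideal.span {(p : ℤ) ^ (m + 1)} := hle h
    rw [Ideal.mem_span_singleton, map_sum] at hY
    simpa only [map_zsmul, augmentation_Tel, smul_eq_mul] using hY
  · rintro ⟨k, hk⟩
    have hW : ∀ i, 1 ≤ i → i ≤ m → (p : ℤ) • Tel p m i - Tel p m (i - 1) ∈ W :=
      fun i h1 h2 => Submodule.subset_span (Or.inr ⟨i, h1, h2, rfl⟩)
    have h0 : (p : ℤ) • Tel p m 0 ∈ W := Submodule.subset_span (Or.inl rfl)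
    have htop : (p : ℤ) ^ (m + 1) • Tel p m m ∈ W := by
      have h1 := Tel_sub_pow_smul_mem hW m le_rfl
      rw [Nat.sub_self] at h1
      have h2 := W.sub_mem h0 (W.smul_mem (p : ℤ) h1)
      rwa [smul_sub, sub_sub_cancel, smul_smul, ← pow_succ'] at h2
    have hdiff : ∑ i ∈ Finset.range (m + 1),
        c i • (Tel p m i - (p : ℤ) ^ (m - i) • Tel p m m) ∈ W := by
      refine W.sum_mem fun i hi => W.smul_mem _ ?_
      have him : i ≤ m := Nat.lt_succ_iff.mp (Finset.mem_range.mp hi)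
      have h1 := Tel_sub_pow_smul_mem hW (m - i) (Nat.sub_le _ _)
      rwa [Nat.sub_sub_self him] at h1
    have hsum := W.add_mem hdiff (W.smul_mem k htop)
    rw [smul_smul, mul_comm k, ← hk] at hsum
    simpa only [smul_sub, smul_smul, Finset.sum_sub_distrib, Finset.sum_smul,
      sub_add_cancel] using hsum

/-- Exactness of `0 → I(C_{p^n}) → A(C_{p^{n-1}}) → ℤ/p^n → 0`: in
`R_{n-1} = ℤ[X]/(X^{p^{n-1}} − 1)` with `S_i = Σ_{t<p^{n-1-i}} x^{t·p^i}`, the element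
`Y = Σ_{i=0}^{n-1} c_i·S_i` lies in the ℤ-span of `{p·S_0} ∪ {p·S_i − S_{i−1} : 1 ≤ i ≤ n−1}`
if and only if `p^n` divides `Σ_{i=0}^{n-1} c_i·p^{n−1−i}`. -/
theorem stmt9 (p n : ℕ) (hp : p.Prime) (hn : 1 ≤ n) (c : ℕ → ℤ) :
    (∑ i ∈ Finset.range n, c i • Tel p (n - 1) i) ∈
      Submodule.span ℤ
        ({(p : ℤ) • Tel p (n - 1) 0} ∪
          {y : Rring p (n - 1) | ∃ i, 1 ≤ i ∧ i ≤ n - 1 ∧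
            y = (p : ℤ) • Tel p (n - 1) i - Tel p (n - 1) (i - 1)})
    ↔ (p : ℤ) ^ n ∣ ∑ i ∈ Finset.range n, c i * (p : ℤ) ^ (n - 1 - i) := by
  obtain ⟨m, rfl⟩ : ∃ m, n = m + 1 := ⟨n - 1, by omega⟩
  exact sum_smul_Tel_mem_span_iff p m c
end

section
/- Let p be a prime, 0 ≤ m ≤ n, and let π : R_n → R_m be the ring homomorphism from ℤ[X]/(X^{p^n} − 1) to ℤ[X]/(X^{p^m} − 1) sending x to x (well defined since X^{p^m} − 1 divides X^{p^n} − 1). For any integers c_0, …, c_n, the element Σ_{i=0}^{n} c_i·T_i lies in the kernel of π if and only if it lies in the ℤ-span of {Z_{m+1}, …, Z_n}. (Equivalently, z_{n,m+1}, …, z_{n,n} form a ℤ-basis of the kernel of the restriction homomorphism A(C_{p^n}) → A(C_{p^m}).) -/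
open Polynomial

open Polynomial in
/-- The ring homomorphism `π : R_n → R_m` sending `x` to `x` (well defined since
`X^{p^m} − 1` divides `X^{p^n} − 1` for `m ≤ n`); it is the restriction homomorphism
`RU(C_{p^n}) → RU(C_{p^m})`. -/
noncomputable def resHom (p m n : ℕ) (hmn : m ≤ n) : Rring p n →+* Rring p m :=
  Ideal.Quotient.lift _
    (Ideal.Quotient.mk (Ideal.span {(X : Polynomial ℤ) ^ p ^ m - 1}))
    (by
      intro f hf
      obtain ⟨g, rfl⟩ := Ideal.mem_span_singleton.mp hf
      rw [map_mul]
      have h : (Ideal.Quotient.mk (Ideal.span {(X : Polynomial ℤ) ^ p ^ m - 1}))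
          ((X : Polynomial ℤ) ^ p ^ n - 1) = 0 := by
        have h2 : xcl p m ^ p ^ n = 1 := by
          have he : p ^ n = p ^ m * p ^ (n - m) := by
            rw [← pow_add]; congr 1; omega
          rw [he, pow_mul, xcl_pow, one_pow]
        have h3 : (Ideal.Quotient.mk (Ideal.span {(X : Polynomial ℤ) ^ p ^ m - 1}))
            ((X : Polynomial ℤ) ^ p ^ n - 1) = xcl p m ^ p ^ n - 1 := by
          rw [map_sub, map_pow, map_one]; rfl
        rw [h3, h2, sub_self]
      rw [h, zero_mul])

theorem geom_sum_mul_of_pow_eq_one {R : Type*} [CommRing R] {y : R} {a : ℕ} (hy : y ^ a = 1)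
    (b : ℕ) : ∑ t ∈ Finset.range (a * b), y ^ t = b * ∑ t ∈ Finset.range a, y ^ t := by
  induction b with
  | zero => simp
  | succ b ih =>
    rw [Nat.mul_succ, Finset.sum_range_add, ih]
    simp only [pow_add, pow_mul, hy, one_pow, one_mul]
    push_cast
    ring

theorem Tel_eq_geom_sum (p n i : ℕ) :
    Tel p n i = ∑ t ∈ Finset.range (p ^ (n - i)), (xcl p n ^ p ^ i) ^ t := by
  simp only [Tel, ← pow_mul, mul_comm]

theorem Tel_self (p n : ℕ) : Tel p n n = 1 := by simp [Tel]

theorem resHom_xcl (p m n : ℕ) (hmn : m ≤ n) : resHom p m n hmn (xcl p n) = xcl p m :=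
  rfl

theorem resHom_Tel_of_le {p m n i : ℕ} (hmn : m ≤ n) (him : i ≤ m) :
    resHom p m n hmn (Tel p n i) = (p : Rring p m) ^ (n - m) * Tel p m i := by
  have hy : (xcl p m ^ p ^ i) ^ p ^ (m - i) = 1 := by
    rw [← pow_mul, ← pow_add, Nat.add_sub_cancel' him, xcl_pow]
  have he : p ^ (n - i) = p ^ (m - i) * p ^ (n - m) := by
    rw [← pow_add]; congr 1; omega
  rw [Tel_eq_geom_sum, Tel_eq_geom_sum, map_sum]
  simp only [map_pow, resHom_xcl]
  rw [he, geom_sum_mul_of_pow_eq_one hy, Nat.cast_pow]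

theorem resHom_Tel_of_ge {p m n i : ℕ} (hmn : m ≤ n) (hmi : m ≤ i) :
    resHom p m n hmn (Tel p n i) = (p : Rring p m) ^ (n - i) := by
  have hy : xcl p m ^ p ^ i = 1 := by
    rw [← Nat.add_sub_cancel' hmi, pow_add, pow_mul, xcl_pow, one_pow]
  rw [Tel_eq_geom_sum, map_sum]
  simp [map_pow, resHom_xcl, hy]

/-- The polynomial `Σ_{t < p^(n-i)} X^(t p^i)`, the reduced representative of `Tel p n i`. -/
noncomputable def telPoly (p n i : ℕ) : Polynomial ℤ :=
  ∑ t ∈ Finset.range (p ^ (n - i)), X ^ (t * p ^ i)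

theorem mk_telPoly (p n i : ℕ) : Ideal.Quotient.mk _ (telPoly p n i) = Tel p n i := by
  simp [telPoly, Tel, xcl]

theorem mul_pow_lt_pow {p n i t : ℕ} (hp : 0 < p) (hi : i ≤ n) (ht : t < p ^ (n - i)) :
    t * p ^ i < p ^ n :=
  calc t * p ^ i < p ^ (n - i) * p ^ i := Nat.mul_lt_mul_of_pos_right ht (pow_pos hp i)
    _ = p ^ n := by rw [← pow_add, Nat.sub_add_cancel hi]

theorem degree_telPoly_lt {p n i : ℕ} (hp : 0 < p) (hi : i ≤ n) :
    (telPoly p n i).degree < (p ^ n : ℕ) := by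
  refine (degree_sum_le _ _).trans_lt ((Finset.sup_lt_iff (WithBot.bot_lt_coe _)).2 ?_)
  intro t ht
  rw [degree_X_pow]
  exact_mod_cast mul_pow_lt_pow hp hi (Finset.mem_range.1 ht)

theorem coeff_zero_telPoly {p : ℕ} (hp : 0 < p) (n i : ℕ) : (telPoly p n i).coeff 0 = 1 := by
  simp [telPoly, coeff_X_pow, eq_comm (a := 0), hp.ne']

theorem coeff_pow_telPoly {p n i j : ℕ} (hp : 1 < p) (hj : j < n) :
    (telPoly p n i).coeff (p ^ j) = if i ≤ j then 1 else 0 := by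
  simp only [telPoly, finsetSum_coeff, coeff_X_pow]
  split_ifs with hij
  · have hp0 : 0 < p := by omega
    have he : ∀ t, p ^ j = t * p ^ i ↔ t = p ^ (j - i) := by
      intro t
      have h : p ^ j = p ^ (j - i) * p ^ i := by rw [← pow_add, Nat.sub_add_cancel hij]
      rw [h, Nat.mul_left_inj (pow_pos hp0 i).ne', eq_comm]
    have hlt : p ^ (j - i) < p ^ (n - i) := Nat.pow_lt_pow_right hp (by omega)
    simp [he, hlt]
  · refine Finset.sum_eq_zero fun t _ => if_neg fun h => hij ?_
    exact (Nat.pow_dvd_pow_iff_le_right hp).1 ⟨t, by rw [h, mul_comm]⟩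

/-- The elements `T_0, …, T_n` of `R_n` are linearly independent over `ℤ`. -/
theorem eq_zero_of_sum_smul_Tel_eq_zero {p n : ℕ} (hp : 1 < p) {b : ℕ → ℤ}
    (h : ∑ i ∈ Finset.range (n + 1), b i • Tel p n i = 0) : ∀ i ≤ n, b i = 0 := by
  have hp0 : 0 < p := by omega
  have hpoly : ∑ i ∈ Finset.range (n + 1), b i • telPoly p n i = 0 := by
    have hdvd : (X : Polynomial ℤ) ^ p ^ n - 1 ∣
        ∑ i ∈ Finset.range (n + 1), b i • telPoly p n i := by
      rw [← Ideal.mem_span_singleton, ← Ideal.Quotient.eq_zero_iff_mem, map_sum, ← h]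
      exact Finset.sum_congr rfl fun i _ => by rw [map_zsmul, mk_telPoly]
    by_contra hne
    have hle := degree_le_of_dvd hdvd hne
    rw [← C_1, degree_X_pow_sub_C (pow_pos hp0 n)] at hle
    refine absurd hle (not_le.2 ?_)
    refine (degree_sum_le _ _).trans_lt ((Finset.sup_lt_iff (WithBot.bot_lt_coe _)).2 ?_)
    intro i hi
    exact (degree_smul_le _ _).trans_lt
      (degree_telPoly_lt hp0 (Nat.lt_succ_iff.1 (Finset.mem_range.1 hi)))
  have hcoeff : ∀ k, ∑ i ∈ Finset.range (n + 1), b i * (telPoly p n i).coeff k = 0 := by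
    intro k
    simpa [finsetSum_coeff] using congrArg (fun f => coeff f k) hpoly
  intro i
  induction i using Nat.strong_induction_on with
  | _ i ih =>
    intro hi
    have hsum : ∑ j ∈ Finset.range (n + 1), b j * (if j ≤ i then 1 else 0) = 0 := by
      rcases hi.lt_or_eq with hlt | rfl
      · simpa only [coeff_pow_telPoly hp hlt] using hcoeff (p ^ i)
      · rw [← hcoeff 0]
        refine Finset.sum_congr rfl fun j hj => ?_
        rw [coeff_zero_telPoly hp0, if_pos (Nat.lt_succ_iff.1 (Finset.mem_range.1 hj))]
    rw [Finset.sum_eq_single i] at hsum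
    · simpa using hsum
    · intro j _ hji
      split_ifs with hle
      · rw [ih j (by omega) (by omega), zero_mul]
      · rw [mul_zero]
    · intro hmem
      exact absurd (Finset.mem_range.2 (by omega)) hmem

theorem resHom_Zel {p m n i : ℕ} (hmn : m ≤ n) (hi : i ∈ Set.Icc (m + 1) n) :
    resHom p m n hmn (Zel p n i) = 0 := by
  obtain ⟨h1, h2⟩ := hi
  rw [Zel, if_neg (by omega), map_sub, map_mul, map_natCast, resHom_Tel_of_ge hmn (by omega),
    resHom_Tel_of_ge hmn (by omega), ← pow_succ', show n - (i - 1) = n - i + 1 by omega, sub_self]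

/-- Modulo the span of `Z_{m+1}, …, Z_n`, each `T_i` with `m ≤ i` is a multiple of `T_n = 1`. -/
theorem Tel_sub_pow_mem_span {p m n i : ℕ} (hmi : m ≤ i) (hin : i ≤ n) :
    Tel p n i - (p : Rring p n) ^ (n - i) ∈
      Submodule.span ℤ ((fun i => Zel p n i) '' Set.Icc (m + 1) n) := by
  induction hin using Nat.decreasingInduction with
  | self => simp [Tel_self]
  | of_succ i hi ih =>
    have hZ : Zel p n (i + 1) ∈ Submodule.span ℤ ((fun i => Zel p n i) '' Set.Icc (m + 1) n) :=
      Submodule.subset_span ⟨i + 1, ⟨by omega, hi⟩, rfl⟩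
    have h := Submodule.sub_mem _ (Submodule.smul_mem _ (p : ℤ) (ih (by omega))) hZ
    convert h using 1
    rw [Zel, if_neg (by omega), show n - i = n - (i + 1) + 1 by omega, Nat.add_sub_cancel,
      zsmul_eq_mul, Int.cast_natCast]
    ring

/-- `z_{n,m+1}, …, z_{n,n}` form a ℤ-basis of the kernel of the restriction
`A(C_{p^n}) → A(C_{p^m})`: an element `Σ_{i=0}^n c_i·T_i` lies in the kernel of
`π : R_n → R_m` if and only if it lies in the ℤ-span of `{Z_{m+1}, …, Z_n}`. -/
theorem stmt10 (p m n : ℕ) (hp : p.Prime) (hmn : m ≤ n) (c : ℕ → ℤ) :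
    resHom p m n hmn (∑ i ∈ Finset.range (n + 1), c i • Tel p n i) = 0
    ↔ (∑ i ∈ Finset.range (n + 1), c i • Tel p n i) ∈
        Submodule.span ℤ ((fun i => Zel p n i) '' Set.Icc (m + 1) n) := by
  have hsplit : ∀ {M : Type} [AddCommGroup M] (f : ℕ → M), ∑ i ∈ Finset.range (n + 1), f i =
      ∑ i ∈ Finset.range m, f i + ∑ i ∈ Finset.Ico m (n + 1), f i := fun f =>
    (Finset.sum_range_add_sum_Ico f (by omega)).symm
  constructor
  · intro h
    set S : ℤ := ∑ i ∈ Finset.Ico m (n + 1), c i * (p : ℤ) ^ (n - i) with hS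
    let b : ℕ → ℤ := fun i => if i < m then c i * (p : ℤ) ^ (n - m) else S
    have hb : ∑ i ∈ Finset.range (m + 1), b i • Tel p m i = 0 := by
      rw [← h, map_sum, hsplit, Finset.sum_range_succ]
      congr 1
      · refine Finset.sum_congr rfl fun i hi => ?_
        have him := Finset.mem_range.1 hi
        rw [map_zsmul, resHom_Tel_of_le hmn him.le]
        simp [b, him, zsmul_eq_mul, mul_assoc]
      · simp only [b, lt_irrefl, if_false, Tel_self, hS, Finset.sum_smul]
        refine Finset.sum_congr rfl fun i hi => ?_
        rw [map_zsmul, resHom_Tel_of_ge hmn (Finset.mem_Ico.1 hi).1]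
        simp [zsmul_eq_mul]
    have hb0 := eq_zero_of_sum_smul_Tel_eq_zero hp.one_lt hb
    have hS0 : S = 0 := by simpa [b] using hb0 m le_rfl
    have hc : ∀ i < m, c i = 0 := fun i hi => by
      simpa [b, hi, hp.ne_zero] using hb0 i hi.le
    have hrw : ∑ i ∈ Finset.range (n + 1), c i • Tel p n i =
        ∑ i ∈ Finset.Ico m (n + 1), c i • (Tel p n i - (p : Rring p n) ^ (n - i)) := by
      have hS1 : ∑ i ∈ Finset.Ico m (n + 1), c i • (p : Rring p n) ^ (n - i) = 0 := by
        simpa [hS, zsmul_eq_mul] using congrArg (Int.cast : ℤ → Rring p n) hS0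
      rw [hsplit, Finset.sum_eq_zero fun i hi => by rw [hc i (Finset.mem_range.1 hi), zero_smul]]
      simp only [smul_sub, Finset.sum_sub_distrib, hS1, zero_add, sub_zero]
    rw [hrw]
    refine Submodule.sum_mem _ fun i hi => Submodule.smul_mem _ _ ?_
    have := Finset.mem_Ico.1 hi
    exact Tel_sub_pow_mem_span this.1 (by omega)
  · intro h
    have hle : Submodule.span ℤ ((fun i => Zel p n i) '' Set.Icc (m + 1) n) ≤
        LinearMap.ker (resHom p m n hmn).toAddMonoidHom.toIntLinearMap := by
      rw [Submodule.span_le]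
      rintro _ ⟨i, hi, rfl⟩
      exact resHom_Zel hmn hi
    exact hle h
end

section
/- Let p be a prime, n ≥ 1, k ≥ 1; write k = p^{l−1}·c with l ≥ 1 and p ∤ c, and set m = k(p−1). For 1 ≤ i ≤ n let b_i be the least multiple of p^{i−1}(p−1) with b_i ≥ m, and set E_i = ∏_{t=m+1}^{b_i} (1 − x^{d_t}) ∈ R_n. Then the additive group {f ∈ R_n : ψ_m^{(ℓ)}(f) = f for every integer ℓ ≥ 1 coprime to p} is free with ℤ-basis {Z_i : 1 ≤ i ≤ min(l,n)} ∪ {E_i·T_i : min(l,n) < i ≤ n}. (This computes the subgroup M^ℂ_{2k(p−1)} of π_{0,2k(p−1)}KU_{C_{p^n}} fixed by all Adams operations ψ^ℓ with p ∤ ℓ.) -/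
open Polynomial

open Polynomial in
/-- The ring homomorphism `σ_ℓ : R_n → R_n` determined by `x ↦ x^ℓ` (well defined
since `(x^ℓ)^{p^n} = 1`). -/
noncomputable def sigmaHom (p n ℓ : ℕ) : Rring p n →+* Rring p n :=
  Ideal.Quotient.lift _ (aeval (R := ℤ) (xcl p n ^ ℓ)).toRingHom (by
    intro f hf
    obtain ⟨g, rfl⟩ := Ideal.mem_span_singleton.mp hf
    have h : (aeval (R := ℤ) (xcl p n ^ ℓ)) ((X : Polynomial ℤ) ^ p ^ n - 1) = 0 := by
      rw [map_sub, map_pow, aeval_X, map_one, ← pow_mul, mul_comm ℓ (p ^ n), pow_mul,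
        xcl_pow, one_pow, sub_self]
    simp only [AlgHom.toRingHom_eq_coe, RingHom.coe_coe, map_mul, h, zero_mul])

/-- `u_m^{(ℓ)} = ∏_{j=1}^m (Σ_{i=0}^{ℓ-1} x^{i·d_j}) ∈ R_n`; the Adams operation `ψ^ℓ`
on `π_{0,2m}KU_{C_{p^n}} ≅ R_n·β_m` is `f ↦ σ_ℓ(f)·u_m^{(ℓ)}`. -/
noncomputable def useq (p n : ℕ) (hp : 0 < p) (ℓ m : ℕ) : Rring p n :=
  ∏ j ∈ Finset.Icc 1 m, ∑ i ∈ Finset.range ℓ, xz p n hp ((i : ℤ) * dseq p j)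

/-- `bfun p k i` is the least multiple of `p^{i-1}(p-1)` that is `≥ m = k(p-1)`. -/
noncomputable def bfun (p k i : ℕ) : ℕ :=
  (p ^ (i - 1) * (p - 1)) *
    ((k * (p - 1) + p ^ (i - 1) * (p - 1) - 1) / (p ^ (i - 1) * (p - 1)))

/-- `E_i = ∏_{t=m+1}^{b_i} (1 - x^{d_t}) ∈ R_n`, where `m = k(p-1)` and `b_i = bfun p k i`. -/
noncomputable def Efun (p n : ℕ) (hp : 0 < p) (k i : ℕ) : Rring p n :=
  ∏ t ∈ Finset.Icc (k * (p - 1) + 1) (bfun p k i), (1 - xz p n hp (dseq p t))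

/-- The claimed basis element: `Z_i` for `i ≤ min(l,n)` and `E_i·T_i` for `i > min(l,n)`. -/
noncomputable def vfun (p n : ℕ) (hp : 0 < p) (k l i : ℕ) : Rring p n :=
  if i ≤ min l n then Zel p n i else Efun p n hp k i * Tel p n i

section PeriodicProducts

variable {M : Type*} [CommMonoid M]

theorem prod_range_add_periodic (w : ℤ → M) (N : ℕ) (hw : ∀ a, w (a + N) = w a) (s : ℤ) :
    ∏ i ∈ Finset.range N, w (s + i) = ∏ i ∈ Finset.range N, w i := by
  have step : ∀ s : ℤ, ∏ i ∈ Finset.range N, w (s + 1 + i) = ∏ i ∈ Finset.range N, w (s + i) := by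
    intro s
    rcases N with _ | N
    · simp
    · rw [Finset.prod_range_succ, Finset.prod_range_succ' (fun i : ℕ => w (s + i))]
      congr 1
      · refine Finset.prod_congr rfl fun i _ => ?_
        congr 1
        push_cast
        ring
      · rw [← hw (s + (0 : ℕ))]
        congr 1
        push_cast
        ring
  induction s using Int.induction_on with
  | zero => simp
  | succ i ih => rw [step, ih]
  | pred i ih => rw [← ih, ← step]; simp

theorem prod_range_mul_periodic (w : ℤ → M) (N : ℕ) (hw : ∀ a, w (a + N) = w a) (q : ℕ) (s : ℤ) :
    ∏ i ∈ Finset.range (q * N), w (s + i) = (∏ i ∈ Finset.range N, w i) ^ q := by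
  induction q with
  | zero => simp
  | succ q ih =>
    rw [Nat.succ_mul, Finset.prod_range_add, ih, pow_succ,
      ← prod_range_add_periodic w N hw (s + (q * N : ℕ))]
    congr 1
    refine Finset.prod_congr rfl fun i _ => ?_
    congr 1
    push_cast
    ring

theorem prod_range_symmetric (w : ℤ → M) (h0 : w 0 = 1) (h : ℕ) :
    ∏ a ∈ Finset.range h, (w ((a + 1 : ℕ) : ℤ) * w (-((a + 1 : ℕ) : ℤ))) =
      ∏ i ∈ Finset.range (2 * h + 1), w (-h + i) := by
  induction h with
  | zero => simp [h0]
  | succ h ih =>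
    rw [Finset.prod_range_succ, ih, show 2 * (h + 1) + 1 = 2 * h + 1 + 1 + 1 by ring,
      Finset.prod_range_succ _ (2 * h + 1 + 1), Finset.prod_range_succ' _ (2 * h + 1)]
    have e1 : (-((h + 1 : ℕ) : ℤ) + ((2 * h + 1 + 1 : ℕ) : ℤ)) = ((h + 1 : ℕ) : ℤ) := by
      push_cast; ring
    rw [e1, mul_assoc, mul_comm (w ((h + 1 : ℕ) : ℤ))]
    congr 1
    · refine Finset.prod_congr rfl fun i _ => ?_
      congr 1
      push_cast
      ring

/-- For an `N`-periodic function that is trivial at `0` and at the midpoint `q * N / 2`, the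
product over the symmetric interval of length `q * N` around `0` consists of `q` full periods. -/
theorem prod_symmetric_periodic (w : ℤ → M) (N : ℕ) (hN : 0 < N) (hw : ∀ a, w (a + N) = w a)
    (h0 : w 0 = 1) (q : ℕ) (hmid : ∀ a : ℤ, 2 * a = q * N → w a = 1) :
    ∏ a ∈ Finset.range ((q * N - 1) / 2), (w ((a + 1 : ℕ) : ℤ) * w (-((a + 1 : ℕ) : ℤ))) =
      (∏ i ∈ Finset.range N, w i) ^ q := by
  rcases Nat.eq_zero_or_pos q with rfl | hq
  · simp
  have hqN : 0 < q * N := Nat.mul_pos hq hN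
  rw [prod_range_symmetric w h0, ← prod_range_mul_periodic w N hw q (-((q * N - 1) / 2 : ℕ))]
  rcases Nat.even_or_odd' (q * N) with ⟨r, hr | hr⟩
  · have e : q * N = 2 * ((q * N - 1) / 2) + 1 + 1 := by omega
    conv_rhs => rw [show Finset.range (q * N) = Finset.range (2 * ((q * N - 1) / 2) + 1 + 1) by
      rw [← e]]
    rw [Finset.prod_range_succ _ (2 * ((q * N - 1) / 2) + 1), hmid, mul_one]
    have : ((q * N : ℕ) : ℤ) = ((2 * ((q * N - 1) / 2) + 1 + 1 : ℕ) : ℤ) := by rw [← e]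
    push_cast at this ⊢
    linarith
  · have e : q * N = 2 * ((q * N - 1) / 2) + 1 := by omega
    rw [← e]

theorem prod_range_count_nth (D : ℕ → Prop) [DecidablePred D] (G : ℕ → M) (h : ℕ) :
    ∏ r ∈ Finset.range (Nat.count D h), G (Nat.nth D r) =
      ∏ a ∈ Finset.range h, if D a then G a else 1 := by
  induction h with
  | zero => simp
  | succ h ih =>
    rw [Finset.prod_range_succ, Nat.count_succ, ← ih]
    split_ifs with hD
    · rw [Finset.prod_range_succ, Nat.nth_count hD]
    · simp

theorem acopr_eq_nth {p : ℕ} (hp : p.Prime) (t : ℕ) :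
    acopr p t = Nat.nth (fun k => ¬ p ∣ k) (t - 1) := by
  unfold acopr
  congr 1
  ext k
  rw [Nat.coprime_comm, hp.coprime_iff_not_dvd]
  constructor
  · exact fun h => h.2
  · refine fun h => ⟨Nat.pos_of_ne_zero ?_, h⟩
    rintro rfl
    exact h (dvd_zero p)

theorem prod_dseq_two_mul {p : ℕ} (hp : p.Prime) (F : ℤ → M) (s : ℕ) :
    ∏ t ∈ Finset.Icc 1 (2 * s), F (dseq p t) =
      ∏ r ∈ Finset.range s, (F (Nat.nth (fun k => ¬ p ∣ k) r : ℕ) *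
        F (-(Nat.nth (fun k => ¬ p ∣ k) r : ℕ))) := by
  induction s with
  | zero => simp
  | succ s ih =>
    rw [show 2 * (s + 1) = 2 * s + 1 + 1 by ring, Finset.prod_Icc_succ_top (by omega),
      Finset.prod_Icc_succ_top (by omega), ih, Finset.prod_range_succ, mul_assoc]
    have h1 : dseq p (2 * s + 1) = (Nat.nth (fun k => ¬ p ∣ k) s : ℕ) := by
      rw [dseq, if_pos (by omega), acopr_eq_nth hp]
      congr 2
      omega
    have h2 : dseq p (2 * s + 1 + 1) = -(Nat.nth (fun k => ¬ p ∣ k) s : ℕ) := by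
      rw [dseq, if_neg (by omega), acopr_eq_nth hp]
      congr 3
      omega
    rw [h1, h2]

theorem not_dvd_nth {p : ℕ} (hp : p.Prime) (r : ℕ) : ¬ p ∣ Nat.nth (fun k => ¬ p ∣ k) r := by
  refine Nat.nth_mem_of_infinite (p := fun k => ¬ p ∣ k) ?_ r
  refine Set.infinite_of_forall_exists_gt fun a => ⟨a * p + 1, ?_, ?_⟩
  · intro h
    exact hp.one_lt.ne' (Nat.dvd_one.mp ((Nat.dvd_add_right (Dvd.intro_left a rfl)).mp h))
  · nlinarith [hp.two_le]

theorem not_dvd_dseq {p : ℕ} (hp : p.Prime) (t : ℕ) : ¬ (p : ℤ) ∣ dseq p t := by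
  unfold dseq
  split_ifs
  · rw [Int.natCast_dvd_natCast, acopr_eq_nth hp]
    exact not_dvd_nth hp _
  · rw [dvd_neg, Int.natCast_dvd_natCast, acopr_eq_nth hp]
    exact not_dvd_nth hp _

theorem prod_dseq_count {p : ℕ} (hp : p.Prime) (F : ℤ → M) (N : ℕ) (hN : 0 < N) (hpN : p ∣ N)
    (hF : ∀ a, F (a + N) = F a) (q : ℕ) (hmid : ∀ a : ℤ, 2 * a = q * N → (p : ℤ) ∣ a) :
    ∏ t ∈ Finset.Icc 1 (2 * Nat.count (fun k => ¬ p ∣ k) ((q * N - 1) / 2 + 1)), F (dseq p t) =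
      (∏ i ∈ Finset.range N, if p ∣ i then 1 else F i) ^ q := by
  have hpN' : (p : ℤ) ∣ N := Int.natCast_dvd_natCast.mpr hpN
  rw [prod_dseq_two_mul hp, prod_range_count_nth (fun k => ¬ p ∣ k)
    (fun a => F (a : ℕ) * F (-(a : ℕ))), Finset.prod_range_succ']
  have key := prod_symmetric_periodic (fun a : ℤ => if (p : ℤ) ∣ a then 1 else F a) N hN
    (fun a => by simp only [Int.dvd_add_left hpN', hF]) (by simp) q
    (fun a ha => if_pos (hmid a ha))
  simp only [dvd_neg, Int.natCast_dvd_natCast] at key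
  rw [← key]
  simp only [dvd_zero, not_true_eq_false, if_false, mul_one]
  refine Finset.prod_congr rfl fun a _ => ?_
  by_cases h : p ∣ a + 1 <;> simp [h]

end PeriodicProducts

theorem card_not_dvd_range_pow {p : ℕ} (hp : p.Prime) {j : ℕ} (hj : 1 ≤ j) :
    ((Finset.range (p ^ j)).filter fun i => ¬ p ∣ i).card = Nat.totient (p ^ j) := by
  rw [Nat.totient]
  congr 1
  refine Finset.filter_congr fun i _ => ?_
  rw [Nat.coprime_pow_left_iff (by omega), hp.coprime_iff_not_dvd]

/-- The first `q * φ(p ^ j)` terms of `dseq p` run `q` times through the units mod `p ^ j`. -/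
theorem prod_dseq_totient {M : Type*} [CommMonoid M] {p : ℕ} (hp : p.Prime) {j : ℕ} (hj : 1 ≤ j)
    (F : ℤ → M) (hF : ∀ a, F (a + (p ^ j : ℕ)) = F a) (q : ℕ) :
    ∏ t ∈ Finset.Icc 1 (q * Nat.totient (p ^ j)), F (dseq p t) =
      (∏ i ∈ Finset.range (p ^ j), if p ∣ i then 1 else F i) ^ q := by
  by_cases h2 : p ^ j = 2
  · have hp2 : p = 2 := (Nat.prime_dvd_prime_iff_eq hp Nat.prime_two).mp
      (h2 ▸ dvd_pow_self p (by omega))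
    rw [h2] at hF ⊢
    subst hp2
    have hper : ∀ k : ℤ, F (1 + 2 * k) = F 1 := by
      intro k
      induction k using Int.induction_on with
      | zero => simp
      | succ i ih => rw [← ih, ← hF (1 + 2 * (i : ℤ))]; congr 1
      | pred i ih => rw [← ih, ← hF]; congr 1; push_cast; ring
    have hconst : ∀ t, F (dseq 2 t) = F 1 := by
      intro t
      have := not_dvd_dseq Nat.prime_two t
      obtain ⟨k, hk⟩ : ∃ k, dseq 2 t = 1 + 2 * k := ⟨dseq 2 t / 2, by omega⟩
      rw [hk, hper]
    simp [hconst, Finset.prod_range_succ]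
  · have hpN : p ∣ p ^ j := dvd_pow_self p (by omega)
    have hmid : ∀ a : ℤ, 2 * a = q * (p ^ j : ℕ) → (p : ℤ) ∣ a := by
      intro a ha
      rcases hp.eq_two_or_odd' with rfl | hodd
      · obtain ⟨i, rfl⟩ : ∃ i, j = i + 2 := by
          refine ⟨j - 2, ?_⟩
          have : j ≠ 1 := by rintro rfl; simp at h2
          omega
        refine ⟨q * 2 ^ i, ?_⟩
        push_cast at ha ⊢
        rw [pow_add] at ha
        linarith
      · have h1 : (p : ℤ) ∣ 2 * a := by
          rw [ha]
          exact Dvd.dvd.mul_left (Int.natCast_dvd_natCast.mpr hpN) _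
        refine (Int.isCoprime_iff_gcd_eq_one.mpr ?_).dvd_of_dvd_mul_left h1
        exact Nat.coprime_two_right.mpr hodd
    have hcount := prod_dseq_count hp (fun _ => 2) (p ^ j) (pow_pos hp.pos j) hpN
      (fun _ => rfl) q hmid
    rw [Finset.prod_const, Finset.prod_ite, Finset.prod_const_one, one_mul, Finset.prod_const,
      card_not_dvd_range_pow hp hj, ← pow_mul, Nat.card_Icc] at hcount
    have := Nat.pow_right_injective le_rfl hcount
    rw [← prod_dseq_count hp F (p ^ j) (pow_pos hp.pos j) hpN hF q hmid]
    congr 2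
    rw [mul_comm q]
    omega

theorem prod_one_sub_pow_of_isPrimitiveRoot_s12 {p : ℕ} (hp : p.Prime) {j : ℕ} (hj : 1 ≤ j) {μ : ℂ}
    (hμ : IsPrimitiveRoot μ (p ^ j)) :
    (∏ i ∈ Finset.range (p ^ j), if p ∣ i then 1 else (1 - μ ^ i)) = p := by
  have := Fact.mk hp
  obtain ⟨i, rfl⟩ : ∃ i, j = i + 1 := ⟨j - 1, by omega⟩
  have h := Polynomial.eval_one_cyclotomic_prime_pow (R := ℂ) (p := p) i
  rw [Polynomial.cyclotomic_eq_prod_X_sub_primitiveRoots hμ, Polynomial.eval_prod] at h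
  simp only [Polynomial.eval_sub, Polynomial.eval_X, Polynomial.eval_C] at h
  rw [← h, Finset.prod_ite, Finset.prod_const_one, one_mul]
  have hpos : 0 < p ^ (i + 1) := pow_pos hp.pos _
  have hco : ∀ a, a.Coprime (p ^ (i + 1)) ↔ ¬ p ∣ a := fun a => by
    rw [Nat.coprime_comm, Nat.coprime_pow_left_iff (by omega), hp.coprime_iff_not_dvd]
  refine Finset.prod_bij (fun a _ => μ ^ a) ?_ ?_ ?_ ?_
  · intro a ha
    rw [mem_primitiveRoots hpos]
    exact hμ.pow_of_coprime a ((hco a).mpr (Finset.mem_filter.mp ha).2)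
  · intro a ha b hb hab
    simp only [Finset.mem_filter, Finset.mem_range] at ha hb
    exact hμ.pow_inj ha.1 hb.1 hab
  · intro ν hν
    rw [mem_primitiveRoots hpos, hμ.isPrimitiveRoot_iff] at hν
    obtain ⟨a, ha, hac, rfl⟩ := hν
    exact ⟨a, by simp [ha, (hco a).mp hac], rfl⟩
  · intros; rfl

/-- The Euler class `∏_{t ≤ m} (1 - x ^ d_t)` evaluated at a complex number. -/
noncomputable def eulerVal (p m : ℕ) (μ : ℂ) : ℂ :=
  ∏ t ∈ Finset.Icc 1 m, (1 - μ ^ dseq p t)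

theorem eulerVal_mul_totient {p : ℕ} (hp : p.Prime) {j : ℕ} (hj : 1 ≤ j) {μ : ℂ}
    (hμ : IsPrimitiveRoot μ (p ^ j)) (q : ℕ) :
    eulerVal p (q * Nat.totient (p ^ j)) μ = (p : ℂ) ^ q := by
  have h0 : μ ≠ 0 := hμ.ne_zero (pow_pos hp.pos j).ne'
  rw [eulerVal, prod_dseq_totient hp hj (fun a : ℤ => 1 - μ ^ a)]
  · congr 1
    simpa using prod_one_sub_pow_of_isPrimitiveRoot_s12 hp hj hμ
  · intro a
    rw [zpow_add₀ h0, zpow_natCast, hμ.pow_eq_one, mul_one]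

theorem eulerVal_eq_mul (p : ℕ) (μ : ℂ) {a b : ℕ} (hab : a ≤ b) :
    eulerVal p b μ = eulerVal p a μ * ∏ t ∈ Finset.Icc (a + 1) b, (1 - μ ^ dseq p t) := by
  obtain ⟨c, rfl⟩ := Nat.exists_eq_add_of_le hab
  induction c with
  | zero => simp
  | succ c ih =>
    rw [← add_assoc, Finset.prod_Icc_succ_top (by omega), ← mul_assoc, ← ih (by omega), eulerVal,
      eulerVal, Finset.prod_Icc_succ_top (by omega)]

section Evaluation

variable {p n : ℕ}

/-- Evaluation of elements of `ℤ[X]/(X^{p^n} - 1)` at a complex `p^n`-th root of unity. -/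
noncomputable def evalAt (p n : ℕ) (μ : ℂ) (h : μ ^ p ^ n = 1) : Rring p n →+* ℂ :=
  Ideal.Quotient.lift _ (aeval (R := ℤ) μ).toRingHom (by
    intro f hf
    obtain ⟨g, rfl⟩ := Ideal.mem_span_singleton.mp hf
    simp [h])

theorem evalAt_mk (μ : ℂ) (h : μ ^ p ^ n = 1) (F : ℤ[X]) :
    evalAt p n μ h (Ideal.Quotient.mk _ F) = aeval μ F := rfl

theorem evalAt_xcl (μ : ℂ) (h : μ ^ p ^ n = 1) : evalAt p n μ h (xcl p n) = μ := by
  rw [xcl, evalAt_mk, aeval_X]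

theorem evalAt_xz (hp : 0 < p) (μ : ℂ) (h : μ ^ p ^ n = 1) (d : ℤ) :
    evalAt p n μ h (xz p n hp d) = μ ^ d := by
  have hu : ((Units.map (evalAt p n μ h : Rring p n →* ℂ) (xunit p n hp) : ℂˣ) : ℂ) = μ :=
    evalAt_xcl μ h
  have := congrArg Units.val (map_zpow (Units.map (evalAt p n μ h : Rring p n →* ℂ))
    (xunit p n hp) d)
  rw [Units.val_zpow_eq_zpow_val, hu] at this
  exact this

theorem pow_pow_eq_one {μ : ℂ} (h : μ ^ p ^ n = 1) (ℓ : ℕ) : (μ ^ ℓ) ^ p ^ n = 1 := by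
  rw [pow_right_comm, h, one_pow]

theorem evalAt_sigmaHom (μ : ℂ) (h : μ ^ p ^ n = 1) (ℓ : ℕ) (f : Rring p n) :
    evalAt p n μ h (sigmaHom p n ℓ f) = evalAt p n (μ ^ ℓ) (pow_pow_eq_one h ℓ) f := by
  obtain ⟨F, rfl⟩ := Ideal.Quotient.mk_surjective f
  have : sigmaHom p n ℓ (Ideal.Quotient.mk _ F) = aeval (xcl p n ^ ℓ) F := rfl
  rw [this, evalAt_mk, aeval_def, aeval_def, hom_eval₂, map_pow, evalAt_xcl]
  congr 1
  exact RingHom.ext_int _ _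

/-- An integral polynomial taking the constant value `y` on at least `natDegree P` roots of a monic
integral polynomial `P` is congruent modulo `P` to an integer constant. -/
theorem exists_dvd_sub_C {P : ℤ[X]} (hP : P.Monic) (S : Finset ℂ) (hS : S.Nonempty)
    (hcard : P.natDegree ≤ S.card) (hroot : ∀ μ ∈ S, aeval μ P = 0) (F : ℤ[X]) (y : ℂ)
    (hF : ∀ μ ∈ S, aeval μ F = y) : ∃ c : ℤ, (c : ℂ) = y ∧ P ∣ F - C c := by
  have hdeg : 0 < P.natDegree := by
    rcases Nat.eq_zero_or_pos P.natDegree with h | h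
    · obtain ⟨μ, hμ⟩ := hS
      have := hroot μ hμ
      rw [hP.natDegree_eq_zero.mp h, map_one] at this
      exact absurd this one_ne_zero
    · exact h
  have hmod : ∀ μ ∈ S, aeval μ (F %ₘ P) = y := by
    intro μ hμ
    rw [← hF μ hμ]
    conv_rhs => rw [← modByMonic_add_div F P]
    rw [map_add, map_mul, hroot μ hμ, zero_mul, add_zero]
  have hlt : (F %ₘ P).natDegree < P.natDegree :=
    natDegree_modByMonic_lt F hP (by rintro rfl; simp at hdeg)
  have hconst : (F %ₘ P).map (algebraMap ℤ ℂ) - C y = 0 := by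
    refine eq_zero_of_natDegree_lt_card_of_eval_eq_zero' _ S (fun μ hμ => ?_) ?_
    · rw [eval_sub, eval_map_algebraMap, hmod μ hμ, eval_C, sub_self]
    · rw [natDegree_sub_C]
      exact lt_of_le_of_lt natDegree_map_le (hlt.trans_le hcard)
  have hcoeff : ∀ i, ((F %ₘ P).coeff i : ℂ) = (C y : ℂ[X]).coeff i := fun i => by
    rw [← sub_eq_zero.mp hconst, coeff_map]; rfl
  refine ⟨(F %ₘ P).coeff 0, by rw [hcoeff, coeff_C_zero], F /ₘ P, ?_⟩
  have hC : F %ₘ P = C ((F %ₘ P).coeff 0) := by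
    ext i
    rcases i with _ | i
    · simp
    · have := hcoeff (i + 1)
      rw [coeff_C_succ] at this ⊢
      exact_mod_cast this
  rw [← hC]
  linear_combination -modByMonic_add_div F P

theorem card_nthRootsFinset_pow (hp : 0 < p) : (nthRootsFinset (p ^ n) (1 : ℂ)).card = p ^ n :=
  (Complex.isPrimitiveRoot_exp (p ^ n) (pow_pos hp n).ne').card_nthRootsFinset

theorem eq_zero_of_evalAt (hp : 0 < p) (f : Rring p n)
    (hf : ∀ μ (h : μ ^ p ^ n = 1), evalAt p n μ h f = 0) : f = 0 := by
  obtain ⟨F, rfl⟩ := Ideal.Quotient.mk_surjective f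
  have hpos : 0 < p ^ n := pow_pos hp n
  obtain ⟨c, hc, hdvd⟩ := exists_dvd_sub_C (monic_X_pow_sub_C (1 : ℤ) hpos.ne')
    (nthRootsFinset (p ^ n) (1 : ℂ)) ⟨1, by simp [mem_nthRootsFinset hpos]⟩
    (by rw [card_nthRootsFinset_pow hp, natDegree_X_pow_sub_C])
    (fun μ hμ => by
      rw [mem_nthRootsFinset hpos] at hμ
      simp [hμ]) F 0
    (fun μ hμ => hf μ ((mem_nthRootsFinset hpos _).mp hμ))
  rw [Int.cast_eq_zero] at hc
  rw [hc, C_0, sub_zero, C_1] at hdvd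
  exact Ideal.Quotient.eq_zero_iff_mem.mpr (Ideal.mem_span_singleton.mpr hdvd)

theorem exists_int_of_evalAt_const (hp : p.Prime) {j : ℕ} (hj : 1 ≤ j) (hjn : j ≤ n)
    (K : Rring p n) (y : ℂ)
    (hK : ∀ μ (h : μ ^ p ^ n = 1), IsPrimitiveRoot μ (p ^ j) → evalAt p n μ h K = y)
    (h1 : evalAt p n 1 (one_pow _) K = 0) : ∃ c : ℤ, y = p * c := by
  have := Fact.mk hp
  obtain ⟨F, rfl⟩ := Ideal.Quotient.mk_surjective K
  have hpos : 0 < p ^ j := pow_pos hp.pos j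
  have hprim := Complex.isPrimitiveRoot_exp (p ^ j) hpos.ne'
  obtain ⟨c, hc, Q, hQ⟩ := exists_dvd_sub_C (cyclotomic.monic (p ^ j) ℤ)
    (primitiveRoots (p ^ j) ℂ) ⟨_, (mem_primitiveRoots hpos).mpr hprim⟩
    (by rw [hprim.card_primitiveRoots, natDegree_cyclotomic])
    (fun μ hμ => by
      have := (mem_primitiveRoots hpos).mp hμ
      rw [aeval_def, ← eval_map, map_cyclotomic]
      exact this.isRoot_cyclotomic hpos) F y
    (fun μ hμ => by
      have hμ' := (mem_primitiveRoots hpos).mp hμ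
      exact hK μ (hμ'.pow_eq_one_iff_dvd _ |>.mpr (pow_dvd_pow p hjn)) hμ')
  obtain ⟨i, rfl⟩ : ∃ i, j = i + 1 := ⟨j - 1, by omega⟩
  have h1' := congrArg (eval 1) hQ
  rw [eval_sub, eval_C, eval_mul, eval_one_cyclotomic_prime_pow] at h1'
  rw [evalAt_mk, show (1 : ℂ) = algebraMap ℤ ℂ 1 by simp, aeval_algebraMap_apply] at h1
  have h1'' : eval 1 F = 0 := by simpa using h1
  rw [h1'', zero_sub] at h1'
  refine ⟨-eval 1 Q, ?_⟩
  rw [← hc, show c = p * -eval 1 Q by linarith]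
  push_cast
  ring

theorem Tel_mul (hj : j ≤ n) : Tel p n j * (xcl p n ^ p ^ j - 1) = 0 := by
  have : Tel p n j = ∑ t ∈ Finset.range (p ^ (n - j)), (xcl p n ^ p ^ j) ^ t :=
    Finset.sum_congr rfl fun t _ => by rw [← pow_mul, mul_comm]
  rw [this, geom_sum_mul, ← pow_mul, ← pow_add, Nat.add_sub_cancel' hj, xcl_pow, sub_self]

theorem evalAt_Tel_of_ne {j : ℕ} (hj : j ≤ n) {μ : ℂ} (h : μ ^ p ^ n = 1) (hμ : μ ^ p ^ j ≠ 1) :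
    evalAt p n μ h (Tel p n j) = 0 := by
  have := congrArg (evalAt p n μ h) (Tel_mul (p := p) hj)
  rw [map_mul, map_sub, map_pow, evalAt_xcl, map_one, map_zero] at this
  exact (mul_eq_zero.mp this).resolve_right (sub_ne_zero.mpr hμ)

theorem evalAt_Tel_of_eq {j : ℕ} {μ : ℂ} (h : μ ^ p ^ n = 1) (hμ : μ ^ p ^ j = 1) :
    evalAt p n μ h (Tel p n j) = (p : ℂ) ^ (n - j) := by
  simp [Tel, evalAt_xcl, mul_comm _ (p ^ j), pow_mul, hμ]

/-- Elements vanishing at all `μ` with `μ ^ p ^ j ≠ 1` are multiples of `T_j`. -/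
theorem exists_eq_Tel_mul (hp : 0 < p) {j : ℕ} (hj : j ≤ n) (f : Rring p n)
    (hf : ∀ μ (h : μ ^ p ^ n = 1), μ ^ p ^ j ≠ 1 → evalAt p n μ h f = 0) :
    ∃ g, f = Tel p n j * g := by
  have h0 : (xcl p n ^ p ^ j - 1) * f = 0 := by
    refine eq_zero_of_evalAt hp _ fun μ h => ?_
    rw [map_mul, map_sub, map_pow, evalAt_xcl, map_one]
    by_cases hμ : μ ^ p ^ j = 1
    · rw [hμ, sub_self, zero_mul]
    · rw [hf μ h hμ, mul_zero]
  obtain ⟨F, rfl⟩ := Ideal.Quotient.mk_surjective f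
  have hmk : (xcl p n ^ p ^ j - 1) * Ideal.Quotient.mk _ F =
      Ideal.Quotient.mk (Ideal.span {(X : ℤ[X]) ^ p ^ n - 1}) ((X ^ p ^ j - 1) * F) := by
    rw [map_mul, map_sub, map_pow, map_one]; rfl
  rw [hmk, Ideal.Quotient.eq_zero_iff_mem, Ideal.mem_span_singleton] at h0
  obtain ⟨G, hG⟩ := h0
  refine ⟨Ideal.Quotient.mk _ G, ?_⟩
  have hne : (X ^ p ^ j - 1 : ℤ[X]) ≠ 0 := (monic_X_pow_sub_C (1 : ℤ) (pow_pos hp j).ne').ne_zero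
  have hgeom : (X ^ p ^ n - 1 : ℤ[X]) =
      (X ^ p ^ j - 1) * ∑ t ∈ Finset.range (p ^ (n - j)), (X ^ p ^ j) ^ t := by
    rw [mul_geom_sum, ← pow_mul, ← pow_add, Nat.add_sub_cancel' hj]
  rw [hgeom, mul_assoc] at hG
  rw [mul_left_cancel₀ hne hG, map_mul, map_sum]
  congr 1
  refine Finset.sum_congr rfl fun t _ => ?_
  rw [← pow_mul, mul_comm, map_pow]
  rfl

end Evaluation

section Fixed

variable {p n : ℕ}

theorem exists_isPrimitiveRoot_pow (hp : p.Prime) {μ : ℂ} (h : μ ^ p ^ n = 1) :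
    ∃ j ≤ n, IsPrimitiveRoot μ (p ^ j) := by
  obtain ⟨j, hj, hord⟩ := (Nat.dvd_prime_pow hp).mp (orderOf_dvd_of_pow_eq_one h)
  exact ⟨j, hj, hord ▸ IsPrimitiveRoot.orderOf μ⟩

theorem eulerVal_one {m : ℕ} (hm : 1 ≤ m) : eulerVal p m 1 = 0 :=
  Finset.prod_eq_zero (Finset.mem_Icc.mpr ⟨le_rfl, hm⟩) (by simp)

theorem eulerVal_ne_zero (hp : p.Prime) {j : ℕ} (hj : 1 ≤ j) {μ : ℂ}
    (hμ : IsPrimitiveRoot μ (p ^ j)) (m : ℕ) : eulerVal p m μ ≠ 0 := by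
  have h := eulerVal_mul_totient hp hj hμ m
  rw [eulerVal_eq_mul p μ (Nat.le_mul_of_pos_right m (Nat.totient_pos.mpr (pow_pos hp.pos j)))] at h
  exact left_ne_zero_of_mul (h ▸ pow_ne_zero m (Nat.cast_ne_zero.mpr hp.ne_zero))

theorem evalAt_useq_mul_eulerVal (hp : 0 < p) {μ : ℂ} (h : μ ^ p ^ n = 1) (ℓ m : ℕ) :
    evalAt p n μ h (useq p n hp ℓ m) * eulerVal p m μ = eulerVal p m (μ ^ ℓ) := by
  rw [useq, map_prod, eulerVal, eulerVal, ← Finset.prod_mul_distrib]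
  refine Finset.prod_congr rfl fun t _ => ?_
  simp only [map_sum, evalAt_xz]
  have e : ∀ i : ℕ, μ ^ ((i : ℤ) * dseq p t) = (μ ^ dseq p t) ^ i := fun i => by
    rw [mul_comm, zpow_mul, zpow_natCast]
  simp only [e]
  rw [geom_sum_mul_neg, ← e, zpow_mul, zpow_natCast]

variable (p n) in
/-- The elements fixed by all Adams operations, described by their values at roots of unity. -/
noncomputable def fixedSubmodule (m : ℕ) : Submodule ℤ (Rring p n) where
  carrier := {f | evalAt p n 1 (one_pow _) f = 0 ∧ ∀ ℓ : ℕ, ℓ.Coprime p → ∀ μ (h : μ ^ p ^ n = 1),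
    evalAt p n (μ ^ ℓ) (pow_pow_eq_one h ℓ) f * eulerVal p m (μ ^ ℓ) =
      evalAt p n μ h f * eulerVal p m μ}
  add_mem' := by
    rintro f g ⟨hf1, hf⟩ ⟨hg1, hg⟩
    refine ⟨by rw [map_add, hf1, hg1, add_zero], fun ℓ hℓ μ h => ?_⟩
    rw [map_add, map_add, add_mul, add_mul, hf ℓ hℓ μ h, hg ℓ hℓ μ h]
  zero_mem' := by simp
  smul_mem' := by
    rintro a f ⟨hf1, hf⟩
    refine ⟨by rw [map_zsmul, hf1, smul_zero], fun ℓ hℓ μ h => ?_⟩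
    rw [map_zsmul, map_zsmul, smul_mul_assoc, smul_mul_assoc, hf ℓ hℓ μ h]

theorem setOf_adams_fixed_eq (hp : p.Prime) {m : ℕ} (hm : 1 ≤ m) :
    {f : Rring p n | ∀ ℓ : ℕ, 1 ≤ ℓ → Nat.Coprime ℓ p →
      sigmaHom p n ℓ f * useq p n hp.pos ℓ m = f} = fixedSubmodule p n m := by
  ext f
  constructor
  · intro hf
    refine ⟨?_, fun ℓ hℓ μ h => ?_⟩
    · have h := congrArg (evalAt p n 1 (one_pow _)) (hf (p + 1) (by omega) (by simp))
      rw [map_mul, evalAt_sigmaHom, useq, map_prod] at h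
      simp only [map_sum, evalAt_xz, one_pow, one_zpow, Finset.sum_const, Finset.card_range,
        Finset.prod_const, Nat.card_Icc, nsmul_eq_mul, mul_one, Nat.add_sub_cancel] at h
      have hne : ((p + 1 : ℕ) : ℂ) ^ m ≠ 1 := by
        norm_cast
        exact (Nat.one_lt_pow (by omega) (by have := hp.pos; omega)).ne'
      by_contra h0
      exact hne ((mul_eq_left₀ h0).mp h)
    · have hpos : 1 ≤ ℓ := by
        rcases Nat.eq_zero_or_pos ℓ with rfl | h'
        · exact absurd ((Nat.coprime_zero_left p).mp hℓ) hp.one_lt.ne'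
        · exact h'
      have hfe := congrArg (evalAt p n μ h) (hf ℓ hpos hℓ)
      rw [map_mul, evalAt_sigmaHom] at hfe
      rw [← hfe, mul_assoc, evalAt_useq_mul_eulerVal]
  · rintro ⟨hf1, hf⟩ ℓ _ hℓ
    rw [← sub_eq_zero]
    refine eq_zero_of_evalAt hp.pos _ fun μ h => ?_
    rw [map_sub, map_mul, evalAt_sigmaHom, sub_eq_zero]
    obtain ⟨j, _, hμ⟩ := exists_isPrimitiveRoot_pow hp h
    rcases Nat.eq_zero_or_pos j with rfl | hj
    · obtain rfl : μ = 1 := by simpa using hμ.pow_eq_one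
      simp only [one_pow, hf1, zero_mul]
    · refine mul_right_cancel₀ (eulerVal_ne_zero hp hj hμ m) ?_
      rw [mul_assoc, evalAt_useq_mul_eulerVal, hf ℓ hℓ μ h]

theorem bfun_spec (hp : p.Prime) {k j : ℕ} (hj : 1 ≤ j) (hm : 1 ≤ k * (p - 1)) :
    ∃ a, bfun p k j = (a + 1) * Nat.totient (p ^ j) ∧ a * Nat.totient (p ^ j) < k * (p - 1) ∧
      k * (p - 1) ≤ (a + 1) * Nat.totient (p ^ j) := by
  have hpos := Nat.totient_pos.mpr (pow_pos hp.pos j)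
  rw [bfun, ← Nat.totient_prime_pow hp hj]
  set φ := Nat.totient (p ^ j)
  set m := k * (p - 1)
  refine ⟨(m - 1) / φ, ?_, ?_, ?_⟩
  · rw [mul_comm, show m + φ - 1 = m - 1 + φ by omega, Nat.add_div_right _ hpos]
  · have := Nat.div_mul_le_self (m - 1) φ
    omega
  · have := Nat.lt_div_mul_add (a := m - 1) hpos
    rw [add_mul, one_mul]
    omega

theorem bfun_eq_of_dvd (hp : p.Prime) {k j : ℕ} (hj : 1 ≤ j) (hm : 1 ≤ k * (p - 1))
    (hdvd : Nat.totient (p ^ j) ∣ k * (p - 1)) : bfun p k j = k * (p - 1) := by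
  obtain ⟨a, hb, hlt, hle⟩ := bfun_spec hp hj hm
  obtain ⟨q, hq⟩ := hdvd
  rw [hq, mul_comm _ q] at hlt hle ⊢
  have h1 := Nat.lt_of_mul_lt_mul_right hlt
  have h2 := Nat.le_of_mul_le_mul_right hle (Nat.totient_pos.mpr (pow_pos hp.pos j))
  rw [hb, show q = a + 1 by omega]

theorem evalAt_Efun (hp : 0 < p) (k j : ℕ) {μ : ℂ} (h : μ ^ p ^ n = 1) :
    evalAt p n μ h (Efun p n hp k j) =
      ∏ t ∈ Finset.Icc (k * (p - 1) + 1) (bfun p k j), (1 - μ ^ dseq p t) := by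
  simp only [Efun, map_prod, map_sub, map_one, evalAt_xz]

theorem eulerVal_mul_evalAt_Efun (hp : p.Prime) {k j : ℕ} (hj : 1 ≤ j) (hm : 1 ≤ k * (p - 1))
    {μ : ℂ} (h : μ ^ p ^ n = 1) :
    eulerVal p (k * (p - 1)) μ * evalAt p n μ h (Efun p n hp.pos k j) =
      eulerVal p (bfun p k j) μ := by
  obtain ⟨a, hb, -, hle⟩ := bfun_spec hp hj hm
  rw [evalAt_Efun, ← eulerVal_eq_mul p μ (hle.trans_eq hb.symm)]

theorem evalAt_Zel_of_ne {j : ℕ} (hj : 1 ≤ j) (hjn : j ≤ n) {μ : ℂ} (h : μ ^ p ^ n = 1)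
    (hμ : μ ^ p ^ j ≠ 1) : evalAt p n μ h (Zel p n j) = 0 := by
  have hμ' : μ ^ p ^ (j - 1) ≠ 1 := fun h1 => hμ (by
    rw [show j = j - 1 + 1 by omega, pow_succ, pow_mul, h1, one_pow])
  rw [Zel, if_neg (by omega), map_sub, map_mul, evalAt_Tel_of_ne hjn h hμ,
    evalAt_Tel_of_ne (by omega) h hμ', mul_zero, sub_zero]

theorem evalAt_Zel_of_pow_pred {j : ℕ} (hj : 1 ≤ j) (hjn : j ≤ n) {μ : ℂ} (h : μ ^ p ^ n = 1)
    (hμ : μ ^ p ^ (j - 1) = 1) : evalAt p n μ h (Zel p n j) = 0 := by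
  have hμ' : μ ^ p ^ j = 1 := by
    rw [show j = j - 1 + 1 by omega, pow_succ, pow_mul, hμ, one_pow]
  rw [Zel, if_neg (by omega), map_sub, map_mul, evalAt_Tel_of_eq h hμ', evalAt_Tel_of_eq h hμ,
    map_natCast, show n - (j - 1) = n - j + 1 by omega, pow_succ, mul_comm, sub_self]

theorem evalAt_Zel_of_isPrimitiveRoot (hp : p.Prime) {j : ℕ} (hj : 1 ≤ j) (hjn : j ≤ n) {μ : ℂ}
    (h : μ ^ p ^ n = 1) (hμ : IsPrimitiveRoot μ (p ^ j)) :
    evalAt p n μ h (Zel p n j) = p * (p : ℂ) ^ (n - j) := by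
  have hμ' : μ ^ p ^ (j - 1) ≠ 1 :=
    hμ.pow_ne_one_of_pos_of_lt (pow_pos hp.pos _).ne' (Nat.pow_lt_pow_right hp.one_lt (by omega))
  rw [Zel, if_neg (by omega), map_sub, map_mul, evalAt_Tel_of_eq h hμ.pow_eq_one,
    evalAt_Tel_of_ne (by omega) h hμ', map_natCast, sub_zero]

theorem evalAt_vfun_of_ne (hp : 0 < p) (k l : ℕ) {j : ℕ} (hj : 1 ≤ j) (hjn : j ≤ n) {μ : ℂ}
    (h : μ ^ p ^ n = 1) (hμ : μ ^ p ^ j ≠ 1) : evalAt p n μ h (vfun p n hp k l j) = 0 := by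
  rw [vfun]
  split_ifs
  · exact evalAt_Zel_of_ne hj hjn h hμ
  · rw [map_mul, evalAt_Tel_of_ne hjn h hμ, mul_zero]

/-- Here `l` is determined by `k`: the index `j` satisfies `j ≤ l` iff `φ(p ^ j)` divides
`k * (p - 1)`. -/
theorem evalAt_vfun_of_isPrimitiveRoot (hp : p.Prime) {k l j : ℕ} (hm : 1 ≤ k * (p - 1))
    (hj : 1 ≤ j) (hjn : j ≤ n) (hl : j ≤ l ↔ Nat.totient (p ^ j) ∣ k * (p - 1)) {μ : ℂ}
    (h : μ ^ p ^ n = 1) (hμ : IsPrimitiveRoot μ (p ^ j)) :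
    evalAt p n μ h (vfun p n hp.pos k l j) = (if j ≤ l then (p : ℂ) else 1) * (p : ℂ) ^ (n - j) *
      evalAt p n μ h (Efun p n hp.pos k j) := by
  by_cases hjl : j ≤ l
  · rw [vfun, if_pos (by omega), if_pos hjl, evalAt_Zel_of_isPrimitiveRoot hp hj hjn h hμ,
      evalAt_Efun, bfun_eq_of_dvd hp hj hm (hl.mp hjl)]
    simp
  · rw [vfun, if_neg (by omega), if_neg hjl, map_mul, evalAt_Tel_of_eq h hμ.pow_eq_one, one_mul,
      mul_comm]

theorem evalAt_vfun_ne_zero (hp : p.Prime) {k l j : ℕ} (hm : 1 ≤ k * (p - 1))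
    (hj : 1 ≤ j) (hjn : j ≤ n) (hl : j ≤ l ↔ Nat.totient (p ^ j) ∣ k * (p - 1)) {μ : ℂ}
    (h : μ ^ p ^ n = 1) (hμ : IsPrimitiveRoot μ (p ^ j)) :
    evalAt p n μ h (vfun p n hp.pos k l j) ≠ 0 := by
  have hp0 : (p : ℂ) ≠ 0 := Nat.cast_ne_zero.mpr hp.ne_zero
  rw [evalAt_vfun_of_isPrimitiveRoot hp hm hj hjn hl h hμ]
  refine mul_ne_zero (mul_ne_zero ?_ (pow_ne_zero _ hp0)) ?_
  · split_ifs
    exacts [hp0, one_ne_zero]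
  · refine right_ne_zero_of_mul (a := eulerVal p (k * (p - 1)) μ) ?_
    rw [eulerVal_mul_evalAt_Efun hp hj hm]
    exact eulerVal_ne_zero hp hj hμ _

theorem vfun_mem_fixedSubmodule (hp : p.Prime) {k l j : ℕ} (hm : 1 ≤ k * (p - 1))
    (hj : 1 ≤ j) (hjn : j ≤ n) (hl : j ≤ l ↔ Nat.totient (p ^ j) ∣ k * (p - 1)) :
    vfun p n hp.pos k l j ∈ fixedSubmodule p n (k * (p - 1)) := by
  have hconst : ∀ i, ∃ y, ∀ μ (h : μ ^ p ^ n = 1), IsPrimitiveRoot μ (p ^ i) →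
      evalAt p n μ h (vfun p n hp.pos k l j) * eulerVal p (k * (p - 1)) μ = y := by
    intro i
    rcases Nat.eq_zero_or_pos i with rfl | hi
    · refine ⟨0, fun μ h hμ => ?_⟩
      obtain rfl : μ = 1 := by simpa using hμ.pow_eq_one
      rw [eulerVal_one hm, mul_zero]
    rcases lt_or_ge j i with hij | hij
    · refine ⟨0, fun μ h hμ => ?_⟩
      rw [evalAt_vfun_of_ne hp.pos k l hj hjn h (hμ.pow_ne_one_of_pos_of_lt
        (pow_pos hp.pos _).ne' (Nat.pow_lt_pow_right hp.one_lt hij)), zero_mul]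
    have hmul : ∀ a, a * Nat.totient (p ^ j) = a * p ^ (j - i) * Nat.totient (p ^ i) := fun a => by
      rw [Nat.totient_prime_pow hp hj, Nat.totient_prime_pow hp hi,
        show j - 1 = j - i + (i - 1) by omega, pow_add]
      ring
    by_cases hjl : j ≤ l
    · rcases hij.lt_or_eq with hij | rfl
      · refine ⟨0, fun μ h hμ => ?_⟩
        rw [vfun, if_pos (by omega), evalAt_Zel_of_pow_pred hj hjn h
          ((hμ.pow_eq_one_iff_dvd _).mpr (pow_dvd_pow p (by omega))), zero_mul]
      · obtain ⟨q, hq⟩ := hl.mp hjl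
        refine ⟨p * (p : ℂ) ^ (n - i) * (p : ℂ) ^ q, fun μ h hμ => ?_⟩
        rw [vfun, if_pos (by omega), evalAt_Zel_of_isPrimitiveRoot hp hj hjn h hμ, hq, mul_comm _ q,
          eulerVal_mul_totient hp hi hμ]
    · obtain ⟨a, hb, -, -⟩ := bfun_spec hp hj hm
      refine ⟨(p : ℂ) ^ ((a + 1) * p ^ (j - i)) * (p : ℂ) ^ (n - j), fun μ h hμ => ?_⟩
      rw [vfun, if_neg (by omega), map_mul, mul_comm, ← mul_assoc,
        eulerVal_mul_evalAt_Efun hp hj hm, hb, hmul, eulerVal_mul_totient hp hi hμ,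
        evalAt_Tel_of_eq h ((hμ.pow_eq_one_iff_dvd _).mpr (pow_dvd_pow p hij))]
  refine ⟨?_, fun ℓ hℓ μ h => ?_⟩
  · by_cases hjl : j ≤ l
    · rw [vfun, if_pos (by omega)]
      exact evalAt_Zel_of_pow_pred hj hjn _ (one_pow _)
    · obtain ⟨a, hb, -, hle⟩ := bfun_spec hp hj hm
      have hlt : k * (p - 1) < bfun p k j := by
        rw [hb]
        refine lt_of_le_of_ne hle fun heq => hjl (hl.mpr ?_)
        rw [heq]
        exact dvd_mul_left _ _
      rw [vfun, if_neg (by omega), map_mul, evalAt_Efun,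
        Finset.prod_eq_zero (Finset.mem_Icc.mpr ⟨le_rfl, hlt⟩) (by simp), zero_mul]
  · obtain ⟨i, _, hμ⟩ := exists_isPrimitiveRoot_pow hp h
    obtain ⟨y, hy⟩ := hconst i
    rw [hy μ h hμ, hy _ _ (hμ.pow_of_coprime ℓ (hℓ.pow_right i))]

/-- Dividing a fixed element supported on levels `≤ j` by the value of `E_j` at level `j` leaves an
integer. -/
theorem exists_int_evalAt_eq (hp : p.Prime) {k j : ℕ} (hm : 1 ≤ k * (p - 1)) (hj : 1 ≤ j)
    (hjn : j ≤ n) {f g : Rring p n} (hf : f ∈ fixedSubmodule p n (k * (p - 1)))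
    (hfg : f = Tel p n j * g) :
    ∃ c : ℤ, ∀ μ (h : μ ^ p ^ n = 1), IsPrimitiveRoot μ (p ^ j) →
      evalAt p n μ h g = c * evalAt p n μ h (Efun p n hp.pos k j) := by
  have hp0 : (p : ℂ) ≠ 0 := Nat.cast_ne_zero.mpr hp.ne_zero
  have : NeZero (p ^ j) := ⟨(pow_pos hp.pos j).ne'⟩
  obtain ⟨a, hb, hlt, -⟩ := bfun_spec hp hj hm
  set m := k * (p - 1)
  set K : Rring p n := g * ∏ t ∈ Finset.Icc (a * Nat.totient (p ^ j) + 1) m,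
    (1 - xz p n hp.pos (dseq p t)) with hK
  have hKeval : ∀ μ (h : μ ^ p ^ n = 1), evalAt p n μ h K = evalAt p n μ h g *
      ∏ t ∈ Finset.Icc (a * Nat.totient (p ^ j) + 1) m, (1 - μ ^ dseq p t) := fun μ h => by
    simp only [hK, map_mul, map_prod, map_sub, map_one, evalAt_xz]
  have hKmul : ∀ μ (h : μ ^ p ^ n = 1), IsPrimitiveRoot μ (p ^ j) →
      evalAt p n μ h f * eulerVal p m μ =
        (p : ℂ) ^ (n - j) * (p : ℂ) ^ a * evalAt p n μ h K := fun μ h hμ => by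
    rw [hKeval, eulerVal_eq_mul p μ hlt.le, eulerVal_mul_totient hp hj hμ, hfg, map_mul,
      evalAt_Tel_of_eq h hμ.pow_eq_one]
    ring
  have hζ := Complex.isPrimitiveRoot_exp (p ^ j) (pow_pos hp.pos j).ne'
  set ζ := Complex.exp (2 * Real.pi * Complex.I / (p ^ j : ℕ))
  have hζn : ζ ^ p ^ n = 1 := (hζ.pow_eq_one_iff_dvd _).mpr (pow_dvd_pow p hjn)
  obtain ⟨c, hc⟩ := exists_int_of_evalAt_const hp hj hjn K (evalAt p n ζ hζn K)
    (fun μ h hμ => by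
      obtain ⟨ℓ, -, hℓ, rfl⟩ := hζ.isPrimitiveRoot_iff.mp hμ
      have hℓ' := (Nat.coprime_pow_right_iff (by omega) ℓ p).mp hℓ
      have := hf.2 ℓ hℓ' ζ hζn
      rw [hKmul _ _ hμ, hKmul _ _ hζ] at this
      exact mul_left_cancel₀ (mul_ne_zero (pow_ne_zero _ hp0) (pow_ne_zero _ hp0)) this)
    (by rw [hKeval, Finset.prod_eq_zero (Finset.mem_Icc.mpr ⟨hlt, le_rfl⟩) (by simp), mul_zero])
  refine ⟨c, fun μ h hμ => ?_⟩
  obtain ⟨ℓ, -, hℓ, rfl⟩ := hζ.isPrimitiveRoot_iff.mp hμ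
  have hℓ' := (Nat.coprime_pow_right_iff (by omega) ℓ p).mp hℓ
  have h1 := hf.2 ℓ hℓ' ζ hζn
  rw [hKmul _ hζn hζ, hc, hfg, map_mul, evalAt_Tel_of_eq _ hμ.pow_eq_one] at h1
  refine mul_right_cancel₀ (eulerVal_ne_zero hp hj hμ m) ?_
  refine mul_left_cancel₀ (pow_ne_zero (n - j) hp0) ?_
  rw [← mul_assoc, h1, mul_assoc (c : ℂ), mul_comm (evalAt p n _ h (Efun p n hp.pos k j)),
    eulerVal_mul_evalAt_Efun hp hj hm, hb, eulerVal_mul_totient hp hj hμ]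
  ring

theorem exists_sub_smul_vfun (hp : p.Prime) {k l j : ℕ} (hm : 1 ≤ k * (p - 1)) (hj : 1 ≤ j)
    (hjn : j ≤ n) (hl : j ≤ l ↔ Nat.totient (p ^ j) ∣ k * (p - 1))
    {f : Rring p n} (hf : f ∈ fixedSubmodule p n (k * (p - 1)))
    (hfj : ∀ μ (h : μ ^ p ^ n = 1), μ ^ p ^ j ≠ 1 → evalAt p n μ h f = 0) :
    ∃ c : ℤ, ∀ μ (h : μ ^ p ^ n = 1), μ ^ p ^ (j - 1) ≠ 1 →
      evalAt p n μ h (f - c • vfun p n hp.pos k l j) = 0 := by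
  have hp0 : (p : ℂ) ≠ 0 := Nat.cast_ne_zero.mpr hp.ne_zero
  obtain ⟨g, hfg⟩ := exists_eq_Tel_mul hp.pos hjn f hfj
  obtain ⟨c, hc⟩ := exists_int_evalAt_eq hp hm hj hjn hf hfg
  obtain ⟨d, hd⟩ : ∃ d : ℤ, (c : ℂ) = d * (if j ≤ l then (p : ℂ) else 1) := by
    by_cases hjl : j ≤ l
    · have hE : ∀ μ (h : μ ^ p ^ n = 1), evalAt p n μ h (Efun p n hp.pos k j) = 1 := fun μ h => by
        rw [evalAt_Efun, bfun_eq_of_dvd hp hj hm (hl.mp hjl)]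
        simp
      have hg1 : evalAt p n 1 (one_pow _) g = 0 := by
        have := hf.1
        rw [hfg, map_mul, evalAt_Tel_of_eq _ (one_pow _)] at this
        exact (mul_eq_zero.mp this).resolve_left (pow_ne_zero _ hp0)
      obtain ⟨d, hd⟩ := exists_int_of_evalAt_const hp hj hjn g c
        (fun μ h hμ => by rw [hc μ h hμ, hE, mul_one]) hg1
      exact ⟨d, by rw [if_pos hjl, hd, mul_comm]⟩
    · exact ⟨c, by rw [if_neg hjl, mul_one]⟩
  refine ⟨d, fun μ h hμ => ?_⟩
  rw [map_sub, map_zsmul, zsmul_eq_mul]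
  by_cases hμj : μ ^ p ^ j = 1
  · have hprim : IsPrimitiveRoot μ (p ^ j) := by
      have := Fact.mk hp
      obtain ⟨i, rfl⟩ : ∃ i, j = i + 1 := ⟨j - 1, by omega⟩
      exact IsPrimitiveRoot.iff_orderOf.mpr (orderOf_eq_prime_pow hμ hμj)
    rw [evalAt_vfun_of_isPrimitiveRoot hp hm hj hjn hl h hprim, hfg, map_mul,
      evalAt_Tel_of_eq h hμj, hc μ h hprim, hd]
    ring
  · rw [hfj μ h hμj, evalAt_vfun_of_ne hp.pos k l hj hjn h hμj, mul_zero, sub_zero]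

theorem fixedSubmodule_eq_span (hp : p.Prime) {k l : ℕ} (hm : 1 ≤ k * (p - 1))
    (hl : ∀ j, 1 ≤ j → (j ≤ l ↔ Nat.totient (p ^ j) ∣ k * (p - 1))) :
    fixedSubmodule p n (k * (p - 1)) =
      Submodule.span ℤ ((fun i => vfun p n hp.pos k l i) '' Set.Icc 1 n) := by
  refine le_antisymm ?_ (Submodule.span_le.mpr ?_)
  · have key : ∀ j ≤ n, ∀ f ∈ fixedSubmodule p n (k * (p - 1)),
        (∀ μ (h : μ ^ p ^ n = 1), μ ^ p ^ j ≠ 1 → evalAt p n μ h f = 0) →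
        f ∈ Submodule.span ℤ ((fun i => vfun p n hp.pos k l i) '' Set.Icc 1 n) := by
      intro j
      induction j with
      | zero =>
        intro _ f hf hfj
        have hf0 : f = 0 := eq_zero_of_evalAt hp.pos f fun μ h => by
          by_cases hμ : μ = 1
          · subst hμ
            exact hf.1
          · exact hfj μ h (by simpa using hμ)
        rw [hf0]
        exact Submodule.zero_mem _
      | succ j ih =>
        intro hjn f hf hfj
        have hj : 1 ≤ j + 1 := Nat.le_add_left 1 j
        obtain ⟨c, hc⟩ := exists_sub_smul_vfun hp hm hj hjn (hl _ hj) hf hfj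
        rw [← sub_add_cancel f (c • vfun p n hp.pos k l (j + 1))]
        refine Submodule.add_mem _ (ih (by omega) _ (Submodule.sub_mem _ hf
          (Submodule.smul_mem _ c (vfun_mem_fixedSubmodule hp hm hj hjn (hl _ hj)))) hc) ?_
        exact Submodule.smul_mem _ c (Submodule.subset_span ⟨j + 1, ⟨hj, hjn⟩, rfl⟩)
    exact fun f hf => key n le_rfl f hf fun μ h hμ => absurd h hμ
  · rintro _ ⟨j, ⟨hj, hjn⟩, rfl⟩
    exact vfun_mem_fixedSubmodule hp hm hj hjn (hl j hj)

theorem linearIndependent_vfun (hp : p.Prime) {k l : ℕ} (hm : 1 ≤ k * (p - 1))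
    (hl : ∀ j, 1 ≤ j → (j ≤ l ↔ Nat.totient (p ^ j) ∣ k * (p - 1))) :
    LinearIndependent ℤ fun i : (Finset.Icc 1 n : Finset ℕ) =>
      vfun p n hp.pos k l (i : ℕ) := by
  rw [Fintype.linearIndependent_iff]
  intro c hc
  by_contra! hne
  obtain ⟨i₀, hi₀⟩ := hne
  obtain ⟨i, hi, hmax⟩ := (Finset.univ.filter fun i => c i ≠ 0).exists_max_image
    (fun i => (i : ℕ)) ⟨i₀, by simpa using hi₀⟩
  obtain ⟨hi1, hin⟩ := Finset.mem_Icc.mp i.2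
  have hζ := Complex.isPrimitiveRoot_exp (p ^ (i : ℕ)) (pow_pos hp.pos i).ne'
  have hζn := (hζ.pow_eq_one_iff_dvd _).mpr (pow_dvd_pow p hin)
  have h := congrArg (evalAt p n _ hζn) hc
  rw [map_sum, map_zero, Finset.sum_eq_single i] at h
  · rw [map_zsmul, zsmul_eq_mul] at h
    refine (mul_ne_zero (Int.cast_ne_zero.mpr (Finset.mem_filter.mp hi).2) ?_) h
    exact evalAt_vfun_ne_zero hp hm hi1 hin (hl _ hi1) hζn hζ
  · intro j _ hji
    obtain ⟨hj1, hjn⟩ := Finset.mem_Icc.mp j.2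
    rw [map_zsmul, zsmul_eq_mul]
    rcases lt_or_ge (j : ℕ) i with hlt | hge
    · rw [evalAt_vfun_of_ne hp.pos k l hj1 hjn hζn (hζ.pow_ne_one_of_pos_of_lt
        (pow_pos hp.pos _).ne' (Nat.pow_lt_pow_right hp.one_lt hlt)), mul_zero]
    · have hcj : c j = 0 := by
        by_contra hcj
        exact hji (Subtype.ext (le_antisymm (hmax j (by simpa using hcj)) hge))
      rw [hcj, Int.cast_zero, zero_mul]
  · simp

theorem le_iff_totient_dvd (hp : p.Prime) {k l c : ℕ} (hl : 1 ≤ l) (hc : ¬ p ∣ c)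
    (hk : k = p ^ (l - 1) * c) {j : ℕ} (hj : 1 ≤ j) :
    j ≤ l ↔ Nat.totient (p ^ j) ∣ k * (p - 1) := by
  rw [Nat.totient_prime_pow hp hj,
    Nat.mul_dvd_mul_iff_right (by have := hp.two_le; omega : 0 < p - 1), hk]
  constructor
  · exact fun h => (pow_dvd_pow p (by omega)).mul_right c
  · intro h
    by_contra! hlt
    refine hc (Nat.dvd_of_mul_dvd_mul_left (pow_pos hp.pos (l - 1)) ?_)
    rw [← pow_succ]
    exact (pow_dvd_pow p (by omega)).trans h

end Fixed

/-- For `k = p^{l-1}·c ≥ 1` with `p ∤ c` and `m = k(p-1)`, the additive group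
`M^ℂ_{2k(p-1)} = {f ∈ R_n : ψ_m^{(ℓ)}(f) = f for all ℓ ≥ 1 coprime to p}` is free with
ℤ-basis `{Z_i : 1 ≤ i ≤ min(l,n)} ∪ {E_i·T_i : min(l,n) < i ≤ n}`. -/
theorem stmt12 (p n k l c : ℕ) (hp : p.Prime) (hn : 1 ≤ n) (hk : 1 ≤ k)
    (hl : 1 ≤ l) (hc : ¬ p ∣ c) (hkeq : k = p ^ (l - 1) * c) :
    (LinearIndependent ℤ fun i : (Finset.Icc 1 n : Finset ℕ) =>
      vfun p n hp.pos k l (i : ℕ)) ∧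
    {f : Rring p n | ∀ ℓ : ℕ, 1 ≤ ℓ → Nat.Coprime ℓ p →
        sigmaHom p n ℓ f * useq p n hp.pos ℓ (k * (p - 1)) = f}
      = ↑(Submodule.span ℤ ((fun i => vfun p n hp.pos k l i) '' Set.Icc 1 n)) := by
  have hm : 1 ≤ k * (p - 1) := Nat.mul_pos hk (by have := hp.two_le; omega)
  have hdvd : ∀ j, 1 ≤ j → (j ≤ l ↔ Nat.totient (p ^ j) ∣ k * (p - 1)) :=
    fun j hj => le_iff_totient_dvd hp hl hc hkeq hj
  refine ⟨linearIndependent_vfun hp hm hdvd, ?_⟩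
  rw [setOf_adams_fixed_eq hp hm, fixedSubmodule_eq_span hp hm hdvd]
end

section
/- Let p be an odd prime, n ≥ 1, k ≥ 1, and 1 ≤ s ≤ n. Set C_s = ⌈(k+1)/(2p^{s−1}(p−1))⌉ and q_s = 2p^{s−1}(p−1)·C_s (the smallest multiple of 2p^{s−1}(p−1) strictly greater than k). Then for every 1 ≤ i ≤ n and every primitive p^i-th root of unity ζ ∈ ℂ: (∏_{t=1}^{q_s/2} (1 − ζ^{d_t})) · (Σ_{r=0}^{p^{n−s}−1} ζ^{r·p^s}) = p^{n−s+p^{s−i}·C_s} if i ≤ s, and = 0 if i > s. (This computes the marks φ̃(y_s)(i) = f^{p,n}_{s,k}(i) of the generators y_s of the Adams-fixed subgroup M_k^{C_{p^n}}.) -/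
section

open Finset

@[to_additive]
theorem prod_range_eq_prod_reflect_pairs {M : Type*} [CommMonoid M] (g : ℕ → M) (L : ℕ)
    (h0 : g 0 = 1) (hmid : Even L → g (L / 2) = 1) :
    ∏ x ∈ range L, g x = ∏ x ∈ range (L / 2), (g (x + 1) * g (L - (x + 1))) := by
  have hshift (h : ℕ) : (∏ x ∈ range h, g x) * g h = ∏ x ∈ range h, g (x + 1) := by
    rw [← prod_range_succ, prod_range_succ', h0, mul_one]
  have hreflect (a h : ℕ) :
      ∏ x ∈ range h, g (a + x) = ∏ x ∈ range h, g (a + h - (x + 1)) := by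
    refine prod_nbij' (h - 1 - ·) (h - 1 - ·) ?_ ?_ ?_ ?_ ?_ <;> intro x hx <;>
      rw [mem_range] at hx <;> try rw [mem_range]
    any_goals omega
    congr 1
    omega
  rw [prod_mul_distrib]
  obtain ⟨h, rfl | rfl⟩ := Nat.even_or_odd' L
  · have hm := hmid (even_two_mul h)
    rw [Nat.mul_div_cancel_left h two_pos] at hm ⊢
    rw [← hshift, hm, mul_one, two_mul, prod_range_add, hreflect]
  · have hd : (2 * h + 1) / 2 = h := by omega
    rw [hd, ← hshift, ← prod_range_succ, show 2 * h + 1 = h + 1 + h by omega, prod_range_add,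
      hreflect]

@[to_additive]
theorem prod_range_of_periodic {M : Type*} [CommMonoid M] {g : ℕ → M} {m : ℕ}
    (hg : Function.Periodic g m) (c : ℕ) :
    ∏ x ∈ range (m * c), g x = (∏ x ∈ range m, g x) ^ c := by
  induction c with
  | zero => simp
  | succ c ih =>
    rw [Nat.mul_succ, prod_range_add, ih, pow_succ]
    congr 1
    refine prod_congr rfl fun x _ => ?_
    rw [add_comm, mul_comm]
    exact hg.nat_mul c x

theorem prod_range_count_nth_s14 {M : Type*} [CommMonoid M] (P : ℕ → Prop) [DecidablePred P]
    (f : ℕ → M) (L : ℕ) :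
    ∏ t ∈ range (Nat.count P L), f (Nat.nth P t) = ∏ x ∈ range L, if P x then f x else 1 := by
  induction L with
  | zero => simp
  | succ L ih =>
    rw [Nat.count_succ, prod_range_succ _ L, ← ih]
    split_ifs with h
    · rw [prod_range_succ, Nat.nth_count h]
    · simp

theorem acopr_succ {p : ℕ} (hp : p ≠ 1) (t : ℕ) :
    acopr p (t + 1) = Nat.nth (fun k => Nat.Coprime k p) t := by
  unfold acopr
  rw [Nat.add_sub_cancel]
  congr 1
  ext k
  refine and_iff_right_of_imp fun h => Nat.pos_of_ne_zero ?_
  rintro rfl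
  exact hp (by simpa using h)

theorem prod_Icc_dseq {M : Type*} [CommMonoid M] {p : ℕ} (hp : p ≠ 1) (f : ℤ → M) (m : ℕ) :
    ∏ t ∈ Icc 1 (2 * m), f (dseq p t) =
      ∏ t ∈ range m, (f (Nat.nth (fun k => Nat.Coprime k p) t) *
        f (-(Nat.nth (fun k => Nat.Coprime k p) t : ℤ))) := by
  induction m with
  | zero => simp
  | succ m ih =>
    have h1 : dseq p (2 * m + 1) = Nat.nth (fun k => Nat.Coprime k p) m := by
      rw [dseq, if_pos (by omega), show (2 * m + 1 + 1) / 2 = m + 1 by omega, acopr_succ hp]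
    have h2 : dseq p (2 * m + 1 + 1) = -(Nat.nth (fun k => Nat.Coprime k p) m : ℤ) := by
      rw [dseq, if_neg (by omega), show (2 * m + 1 + 1) / 2 = m + 1 by omega, acopr_succ hp]
    rw [Nat.mul_succ, prod_Icc_succ_top (by omega), prod_Icc_succ_top (by omega), ih,
      prod_range_succ, h1, h2, mul_assoc]

theorem coprime_sub_iff {p L x : ℕ} (hL : p ∣ L) (hx : x ≤ L) :
    Nat.Coprime (L - x) p ↔ Nat.Coprime x p := by
  obtain ⟨c, rfl⟩ := hL
  rw [← Nat.isCoprime_iff_coprime, ← Nat.isCoprime_iff_coprime, Nat.cast_sub hx,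
    ← IsCoprime.neg_left_iff (x : ℤ),
    sub_eq_neg_add, Nat.cast_mul, IsCoprime.add_mul_left_left_iff]

theorem not_coprime_half_of_even {p s c : ℕ} (hp : p.Prime) (hodd : Odd p) (hs : 1 ≤ s)
    (h : Even (p ^ s * c)) : ¬ Nat.Coprime (p ^ s * c / 2) p := by
  obtain ⟨d, rfl⟩ := (Nat.even_mul.1 h).resolve_left
    (Nat.not_even_iff_odd.2 hodd.pow) |>.two_dvd
  rw [mul_left_comm, Nat.mul_div_cancel_left _ two_pos]
  exact fun hc => hp.one_lt.ne' (Nat.eq_one_of_dvd_coprimes hc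
    ((dvd_pow_self p (by omega)).mul_right d) dvd_rfl)

theorem count_coprime_half {p s : ℕ} (hp : p.Prime) (hodd : Odd p) (hs : 1 ≤ s) (c : ℕ) :
    2 * Nat.count (fun k => Nat.Coprime k p) (p ^ s * c / 2 + 1) =
      p ^ (s - 1) * (p - 1) * c := by
  set g : ℕ → ℕ := fun x => if Nat.Coprime x p then 1 else 0 with hg
  have hcount (L : ℕ) : Nat.count (fun k => Nat.Coprime k p) L = ∑ x ∈ range L, g x := by
    rw [Nat.count_eq_card_filter_range, card_filter]
  have hdvd : p ∣ p ^ s := dvd_pow_self p (by omega)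
  have h0 : g 0 = 0 := by simp [hg, hp.ne_one]
  have hmid : Even (p ^ s * c) → g (p ^ s * c / 2) = 0 :=
    fun h => if_neg (not_coprime_half_of_even hp hodd hs h)
  have hper : Function.Periodic g (p ^ s) := by
    intro x
    obtain ⟨d, hd⟩ := hdvd
    simp only [hg, hd, Nat.coprime_add_mul_left_left]
  have hpairs := sum_range_eq_sum_reflect_pairs g (p ^ s * c) h0 hmid
  rw [sum_range_of_periodic hper, ← hcount, Nat.count_eq_card_filter_range] at hpairs
  have htot : #{x ∈ range (p ^ s) | Nat.Coprime x p} = p ^ (s - 1) * (p - 1) := by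
    rw [← Nat.totient_prime_pow hp (by omega), Nat.totient_eq_card_coprime]
    congr 1
    refine filter_congr fun x _ => ?_
    rw [Nat.coprime_pow_left_iff (by omega), Nat.coprime_comm]
  rw [htot, smul_eq_mul] at hpairs
  rw [hcount, sum_range_succ', h0, add_zero, mul_comm (p ^ (s - 1) * (p - 1)), hpairs, mul_sum]
  refine sum_congr rfl fun x hx => ?_
  rw [mem_range] at hx
  simp only [hg, coprime_sub_iff (hdvd.mul_right c) (show x + 1 ≤ p ^ s * c by omega)]
  ring

theorem prod_one_sub_pow_coprime {p i : ℕ} (hp : p.Prime) (hi : 1 ≤ i) {ζ : ℂ}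
    (hζ : IsPrimitiveRoot ζ (p ^ i)) :
    ∏ x ∈ range (p ^ i), (if Nat.Coprime x p then 1 - ζ ^ x else 1) = (p : ℂ) := by
  have := Fact.mk hp
  obtain ⟨j, rfl⟩ := Nat.exists_eq_add_of_le' hi
  have hpos : 0 < p ^ (j + 1) := pow_pos hp.pos _
  rw [← Polynomial.eval_one_cyclotomic_prime_pow (R := ℂ) j,
    Polynomial.cyclotomic_eq_prod_X_sub_primitiveRoots hζ, Polynomial.eval_prod, ← prod_filter]
  refine prod_nbij (fun x => ζ ^ x) ?_ ?_ ?_ ?_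
  · intro x hx
    rw [mem_primitiveRoots hpos]
    exact hζ.pow_of_coprime x ((mem_filter.1 hx).2.pow_right _)
  · intro x hx y hy h
    simp only [coe_filter, mem_range, Set.mem_ofPred_eq] at hx hy
    exact hζ.pow_inj hx.1 hy.1 h
  · intro ξ hξ
    rw [mem_coe, mem_primitiveRoots hpos] at hξ
    obtain ⟨x, hx, hc, rfl⟩ := (hζ.isPrimitiveRoot_iff).1 hξ
    exact ⟨x, by simpa [hx] using (Nat.coprime_pow_right_iff (by omega) _ _).1 hc, rfl⟩
  · simp

theorem prod_one_sub_zpow_dseq {p s i : ℕ} (hp : p.Prime) (hodd : Odd p) (hi : 1 ≤ i)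
    (his : i ≤ s) (c : ℕ) {ζ : ℂ} (hζ : IsPrimitiveRoot ζ (p ^ i)) :
    ∏ t ∈ Icc 1 (p ^ (s - 1) * (p - 1) * c), (1 - ζ ^ dseq p t) =
      (p : ℂ) ^ (p ^ (s - i) * c) := by
  have hs : 1 ≤ s := hi.trans his
  have hζ0 : ζ ≠ 0 := hζ.ne_zero (pow_pos hp.pos i).ne'
  have hL : p ^ s * c = p ^ i * (p ^ (s - i) * c) := by
    rw [← mul_assoc, ← pow_add, Nat.add_sub_cancel' his]
  have hζL : ζ ^ (p ^ s * c) = 1 := by rw [hL, pow_mul, hζ.pow_eq_one, one_pow]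
  have hdvd : p ∣ p ^ s := dvd_pow_self p (by omega)
  set g : ℕ → ℂ := fun x => if Nat.Coprime x p then 1 - ζ ^ x else 1 with hg
  have h0 : g 0 = 1 := by simp [hg, hp.ne_one]
  have hmid : Even (p ^ s * c) → g (p ^ s * c / 2) = 1 :=
    fun h => if_neg (not_coprime_half_of_even hp hodd hs h)
  have hper : Function.Periodic g (p ^ i) := by
    intro x
    obtain ⟨d, hd⟩ : p ∣ p ^ i := dvd_pow_self p (by omega)
    have : Nat.Coprime (x + p ^ i) p ↔ Nat.Coprime x p := by
      rw [hd, Nat.coprime_add_mul_left_left]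
    simp only [hg, this, pow_add, hζ.pow_eq_one, mul_one]
  rw [← count_coprime_half hp hodd hs, prod_Icc_dseq hp.ne_one (fun d => 1 - ζ ^ d),
    prod_range_count_nth_s14 (fun k => Nat.Coprime k p)
      (fun x : ℕ => (1 - ζ ^ (x : ℤ)) * (1 - ζ ^ (-(x : ℤ)))), prod_range_succ',
    if_neg (by simpa using hp.ne_one), mul_one]
  trans ∏ x ∈ range (p ^ s * c), g x
  · rw [prod_range_eq_prod_reflect_pairs g _ h0 hmid]
    refine prod_congr rfl fun x hx => ?_
    rw [mem_range] at hx
    have hle : x + 1 ≤ p ^ s * c := by omega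
    have hinv : ζ ^ (p ^ s * c - (x + 1)) = ζ ^ (-((x + 1 : ℕ) : ℤ)) := by
      rw [pow_sub₀ _ hζ0 hle, hζL, one_mul, zpow_neg, zpow_natCast]
    simp only [hg, coprime_sub_iff (hdvd.mul_right c) hle, hinv, zpow_natCast]
    split_ifs <;> simp
  · rw [hL, prod_range_of_periodic hper, prod_one_sub_pow_coprime hp hi hζ]

theorem sum_range_pow_mul_prime_pow {p n s i : ℕ} (hp : p.Prime) (hsn : s ≤ n) (hin : i ≤ n)
    {ζ : ℂ} (hζ : IsPrimitiveRoot ζ (p ^ i)) :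
    ∑ r ∈ range (p ^ (n - s)), ζ ^ (r * p ^ s) = if i ≤ s then (p : ℂ) ^ (n - s) else 0 := by
  simp only [mul_comm _ (p ^ s), pow_mul]
  split_ifs with his
  · have h1 : ζ ^ p ^ s = 1 := (hζ.pow_eq_one_iff_dvd _).2 (pow_dvd_pow p his)
    simp [h1]
  · have hne : ζ ^ p ^ s ≠ 1 := fun h =>
      his ((Nat.pow_dvd_pow_iff_le_right hp.one_lt).1 ((hζ.pow_eq_one_iff_dvd _).1 h))
    rw [geom_sum_eq hne, ← pow_mul, ← pow_add, Nat.add_sub_cancel' hsn,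
      (hζ.pow_eq_one_iff_dvd _).2 (pow_dvd_pow p hin), sub_self, zero_div]

end

/-- Marks of the generators `y_s = a^{q_s-k}·t_{n,s}·β_{q_s/2}` of `M_k^{C_{p^n}}` for odd `p`:
with `C_s = ⌈(k+1)/(2p^{s-1}(p-1))⌉` and `q_s = 2p^{s-1}(p-1)·C_s`, for every `1 ≤ i ≤ n`
and every primitive `p^i`-th root of unity `ζ`,
`(∏_{t=1}^{q_s/2} (1 − ζ^{d_t})) · (Σ_{r=0}^{p^{n−s}−1} ζ^{r·p^s})` equals
`p^{n−s+p^{s−i}·C_s}` if `i ≤ s`, and `0` if `i > s`. -/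
theorem stmt14 (p n k s : ℕ) (hp : p.Prime) (hodd : Odd p) (hn : 1 ≤ n) (hk : 1 ≤ k)
    (hs1 : 1 ≤ s) (hsn : s ≤ n) (i : ℕ) (hi1 : 1 ≤ i) (hin : i ≤ n)
    (ζ : ℂ) (hζ : IsPrimitiveRoot ζ (p ^ i)) :
    (∏ t ∈ Finset.Icc 1
        (p ^ (s - 1) * (p - 1) *
          ((k + 2 * p ^ (s - 1) * (p - 1)) / (2 * p ^ (s - 1) * (p - 1)))),
        (1 - ζ ^ dseq p t)) *
      (∑ r ∈ Finset.range (p ^ (n - s)), ζ ^ (r * p ^ s)) =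
    if i ≤ s then
      (p : ℂ) ^ (n - s + p ^ (s - i) *
        ((k + 2 * p ^ (s - 1) * (p - 1)) / (2 * p ^ (s - 1) * (p - 1))))
    else 0 := by
  rw [sum_range_pow_mul_prime_pow hp hsn hin hζ]
  split_ifs with his
  · rw [prod_one_sub_zpow_dseq hp hodd hi1 his _ hζ, ← pow_add, add_comm]
  · rw [mul_zero]
end
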